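/- There exists an absolute constant K>0 such that for every ψ∈𝔐_∞^+, every β∈ℝ, every convex modulus of continuity ω, and every n∈ℕ with μ(ψ;n)>2, one has |E_n(C^ψ_β H_{ω_C})_C − (2/π)·ψ(n)·e_n(ω)| ≤ K·γ_n(ψ)·ω(1/n). -/

import Mathlib

open Real MeasureTheory Filter

noncomputable section

/-- `ω` is a modulus of continuity: continuous, nondecreasing, subadditive on `[0,∞)`,
nonnegative, and `ω 0 = 0`. -/
def IsModulus (ω : ℝ → ℝ) : Prop :=
  ContinuousOn ω (Set.Ici 0) ∧ MonotoneOn ω (Set.Ici 0) ∧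
  (∀ s t : ℝ, 0 ≤ s → 0 ≤ t → ω (s + t) ≤ ω s + ω t) ∧ ω 0 = 0 ∧
  ∀ t : ℝ, 0 ≤ t → 0 ≤ ω t

/-- `ψ` belongs to `𝔐_∞^+`, where `η t = ψ⁻¹(ψ t / 2)` (i.e. `η t ≥ t` and
`ψ (η t) = ψ t / 2`) and `μ t = t / (η t − t)` is nondecreasing and tends to `∞`. -/
def IsMInfPlus (ψ η : ℝ → ℝ) : Prop :=
  (∀ t ≥ (1:ℝ), 0 < ψ t) ∧ ContinuousOn ψ (Set.Ici 1) ∧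
  ConvexOn ℝ (Set.Ici 1) ψ ∧ Tendsto ψ atTop (nhds 0) ∧
  (∀ t ≥ (1:ℝ), t < η t ∧ ψ (η t) = ψ t / 2) ∧
  MonotoneOn (fun t => t / (η t - t)) (Set.Ici 1) ∧
  Tendsto (fun t => t / (η t - t)) atTop atTop

/-- `T` is a trigonometric polynomial of degree at most `n − 1`. -/
def IsTrigPoly (n : ℕ) (T : ℝ → ℝ) : Prop :=
  ∃ a b : ℕ → ℝ,
    ∀ x, T x = ∑ k ∈ Finset.range n, (a k * Real.cos (k * x) + b k * Real.sin (k * x))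

/-- The kernel `Ψ_β(t) = ∑_{k=1}^∞ ψ(k) cos(kt − βπ/2)`. -/
def PsiKer (ψ : ℝ → ℝ) (β : ℝ) (t : ℝ) : ℝ :=
  ∑' k : ℕ, ψ (k + 1) * Real.cos ((k + 1) * t - β * π / 2)

/-- The class `C^ψ_β H_{ω_C}`. -/
def CClass (ψ : ℝ → ℝ) (β : ℝ) (ω : ℝ → ℝ) : Set (ℝ → ℝ) :=
  {f | Continuous f ∧ Function.Periodic f (2 * π) ∧
    ∃ a₀ : ℝ, ∃ φ : ℝ → ℝ, Continuous φ ∧ Function.Periodic φ (2 * π) ∧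
      (∫ t in (-π)..π, φ t) = 0 ∧
      (∀ t : ℝ, 0 ≤ t → ∀ x h : ℝ, |h| ≤ t → |φ (x + h) - φ x| ≤ ω t) ∧
      ∀ x, f x = a₀ / 2 + (1 / π) * ∫ t in (-π)..π, φ (x - t) * PsiKer ψ β t}

/-- Best uniform approximation of `f` by trigonometric polynomials of degree `≤ n − 1`. -/
def EnC (n : ℕ) (f : ℝ → ℝ) : ℝ :=
  sInf {e | ∃ T : ℝ → ℝ, IsTrigPoly n T ∧ e = ⨆ x : ℝ, |f x - T x|}

/-- Best uniform approximation of a class of functions. -/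
def EnCClass (n : ℕ) (N : Set (ℝ → ℝ)) : ℝ := sSup (EnC n '' N)

/-- `e_n(ω) = ∫_0^{π/2} ω(2t/n) sin t dt`. -/
def eN (n : ℕ) (ω : ℝ → ℝ) : ℝ := ∫ t in (0:ℝ)..(π / 2), ω (2 * t / n) * Real.sin t

/-- `γ_n(ψ) = ψ(n+1)(1/n + 1/(μ(n)−2)) + ψ(3n)(1 + ln⁺(η(n)−n))`. -/
def gammaN (ψ η : ℝ → ℝ) (n : ℕ) : ℝ :=
  ψ (n + 1) * (1 / n + 1 / ((n : ℝ) / (η n - n) - 2)) +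
    ψ (3 * n) * (1 + max 0 (Real.log (η n - n)))


lemma tp_add {n : ℕ} {S T : ℝ → ℝ} (hS : IsTrigPoly n S) (hT : IsTrigPoly n T) :
    IsTrigPoly n (fun x => S x + T x) := by
  obtain ⟨a, b, h⟩ := hS
  obtain ⟨c, d, h'⟩ := hT
  refine ⟨fun k => a k + c k, fun k => b k + d k, fun x => ?_⟩
  simp only [h, h', ← Finset.sum_add_distrib]
  exact Finset.sum_congr rfl fun k _ => by ring

lemma tp_smul {n : ℕ} {S : ℝ → ℝ} (c : ℝ) (hS : IsTrigPoly n S) :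
    IsTrigPoly n (fun x => c * S x) := by
  obtain ⟨a, b, h⟩ := hS
  refine ⟨fun k => c * a k, fun k => c * b k, fun x => ?_⟩
  simp only [h, Finset.mul_sum]
  exact Finset.sum_congr rfl fun k _ => by ring

lemma tp_zero (n : ℕ) : IsTrigPoly n (fun _ => 0) :=
  ⟨fun _ => 0, fun _ => 0, fun x => by simp⟩

lemma tp_sum {n : ℕ} {ι : Type*} (s : Finset ι) (S : ι → ℝ → ℝ)
    (hS : ∀ i ∈ s, IsTrigPoly n (S i)) : IsTrigPoly n (fun x => ∑ i ∈ s, S i x) := by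
  classical
  induction s using Finset.induction_on with
  | empty => simpa using tp_zero n
  | insert i s hi ih =>
    simp only [Finset.sum_insert hi]
    exact tp_add (hS i (Finset.mem_insert_self i s))
      (ih fun j hj => hS j (Finset.mem_insert_of_mem hj))

lemma tp_cosnat {n k : ℕ} (hk : k < n) (θ : ℝ) :
    IsTrigPoly n (fun x => Real.cos (k * x - θ)) := by
  refine ⟨fun j => if j = k then Real.cos θ else 0, fun j => if j = k then Real.sin θ else 0,
    fun x => ?_⟩
  rw [Finset.sum_eq_single k]
  · simp [Real.cos_sub]; ring
  · intro b _ hb; simp [hb]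
  · intro h; simp at h; omega

lemma tp_cos {n : ℕ} {k : ℤ} (hk : |k| < n) (θ : ℝ) :
    IsTrigPoly n (fun x => Real.cos (k * x - θ)) := by
  rcases le_total 0 k with h | h
  · lift k to ℕ using h
    have : k < n := by simpa using hk
    simpa using tp_cosnat this θ
  · obtain ⟨j, hj⟩ := Int.exists_eq_neg_ofNat h
    subst hj
    have : j < n := by simpa using hk
    have h2 := tp_cosnat this (-θ)
    have e : (fun x : ℝ => Real.cos (((-(j:ℤ) : ℤ) : ℝ) * x - θ)) =
      fun x => Real.cos (j * x - -θ) := by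
      funext x
      rw [← Real.cos_neg]; congr 1; push_cast; ring
    rw [e]; exact h2

lemma tp_const {n : ℕ} (hn : 0 < n) (c : ℝ) : IsTrigPoly n (fun _ => c) := by
  have := tp_smul c (tp_cosnat hn 0)
  simpa using this

lemma tp_cont {n : ℕ} {S : ℝ → ℝ} (hS : IsTrigPoly n S) : Continuous S := by
  obtain ⟨a, b, h⟩ := hS
  have : S = fun x => ∑ k ∈ Finset.range n, (a k * Real.cos (k * x) + b k * Real.sin (k * x)) :=
    funext h
  rw [this]; fun_prop

lemma tp_per {n : ℕ} {S : ℝ → ℝ} (hS : IsTrigPoly n S) : Function.Periodic S (2 * π) := by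
  obtain ⟨a, b, h⟩ := hS
  intro x
  rw [h, h]
  refine Finset.sum_congr rfl fun k _ => ?_
  have e : (k:ℝ) * (x + 2 * π) = k * x + k * (2 * π) := by ring
  rw [e, Real.cos_add_nat_mul_two_pi, Real.sin_add_nat_mul_two_pi]

lemma tp_conv {n : ℕ} {V : ℝ → ℝ} (hV : IsTrigPoly n V) {g : ℝ → ℝ} (hg : Continuous g)
    (a b : ℝ) : IsTrigPoly n (fun x => ∫ t in a..b, V (x - t) * g t) := by
  obtain ⟨c, d, h⟩ := hV
  refine ⟨fun k => ∫ t in a..b, (c k * Real.cos (k * t) - d k * Real.sin (k * t)) * g t,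
    fun k => ∫ t in a..b, (c k * Real.sin (k * t) + d k * Real.cos (k * t)) * g t, fun x => ?_⟩
  simp only [h, Finset.sum_mul]
  rw [intervalIntegral.integral_finsetSum]
  · refine Finset.sum_congr rfl fun k _ => ?_
    rw [← intervalIntegral.integral_mul_const, ← intervalIntegral.integral_mul_const,
      ← intervalIntegral.integral_add]
    · refine intervalIntegral.integral_congr fun t _ => ?_
      simp only [mul_sub, Real.cos_sub, Real.sin_sub]; ring
    · exact Continuous.intervalIntegrable (by fun_prop) _ _
    · exact Continuous.intervalIntegrable (by fun_prop) _ _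
  · intro k _
    exact Continuous.intervalIntegrable (by fun_prop) _ _

/-- flipping a convolution of periodic continuous functions -/
lemma conv_flip {φ g : ℝ → ℝ} (hφ : Function.Periodic φ (2 * π))
    (hg : Function.Periodic g (2 * π)) (x : ℝ) :
    ∫ t in (-π)..π, φ (x - t) * g t = ∫ t in (-π)..π, g (x - t) * φ t := by
  have h1 := intervalIntegral.integral_comp_sub_left (a := -π) (b := π)
    (fun u => φ u * g (x - u)) x
  simp only [sub_sub_cancel] at h1
  rw [h1]
  have hp : Function.Periodic (fun u => φ u * g (x - u)) (2 * π) := by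
    intro u
    have : x - (u + 2 * π) = (x - u) - 2 * π := by ring
    simp only [hφ u, this, hg.sub_eq]
  have h2 := hp.intervalIntegral_add_eq (x - π) (-π)
  have e1 : x - π + 2 * π = x - -π := by ring
  have e2 : -π + 2 * π = π := by ring
  rw [e1, e2] at h2
  rw [h2]
  refine intervalIntegral.integral_congr fun t _ => ?_
  ring

/-- best approximation of the convolution by polynomials is at most `B`. -/
def PP (n : ℕ) (φ g : ℝ → ℝ) (B : ℝ) : Prop :=
  ∃ T, IsTrigPoly n T ∧ ∀ x, |(1 / π) * (∫ t in (-π)..π, φ (x - t) * g t) - T x| ≤ B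

lemma PP_mono {n : ℕ} {φ g : ℝ → ℝ} {B B' : ℝ} (h : PP n φ g B) (hB : B ≤ B') : PP n φ g B' := by
  obtain ⟨T, hT, h⟩ := h
  exact ⟨T, hT, fun x => (h x).trans hB⟩

lemma PP_add {n : ℕ} {φ g g' : ℝ → ℝ} {B B' : ℝ} (hφ : Continuous φ) (hg : Continuous g)
    (hg' : Continuous g') (h : PP n φ g B) (h' : PP n φ g' B') :
    PP n φ (fun t => g t + g' t) (B + B') := by
  obtain ⟨T, hT, h⟩ := h
  obtain ⟨T', hT', h'⟩ := h'
  refine ⟨_, tp_add hT hT', fun x => ?_⟩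
  have : ∫ t in (-π)..π, φ (x - t) * (g t + g' t) =
      (∫ t in (-π)..π, φ (x - t) * g t) + ∫ t in (-π)..π, φ (x - t) * g' t := by
    rw [← intervalIntegral.integral_add]
    · simp only [mul_add]
    · exact Continuous.intervalIntegrable (by fun_prop) _ _
    · exact Continuous.intervalIntegrable (by fun_prop) _ _
  rw [this]
  calc _ = |((1 / π) * (∫ t in (-π)..π, φ (x - t) * g t) - T x) +
        ((1 / π) * (∫ t in (-π)..π, φ (x - t) * g' t) - T' x)| := by congr 1; ring
    _ ≤ _ := (abs_add_le _ _).trans (add_le_add (h x) (h' x))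

lemma PP_smul {n : ℕ} {φ g : ℝ → ℝ} {B : ℝ} (c : ℝ) (h : PP n φ g B) :
    PP n φ (fun t => c * g t) (|c| * B) := by
  obtain ⟨T, hT, h⟩ := h
  refine ⟨_, tp_smul c hT, fun x => ?_⟩
  have : ∫ t in (-π)..π, φ (x - t) * (c * g t) = c * ∫ t in (-π)..π, φ (x - t) * g t := by
    rw [← intervalIntegral.integral_const_mul]
    refine intervalIntegral.integral_congr fun t _ => ?_
    ring
  rw [this]
  calc _ = |c * ((1 / π) * (∫ t in (-π)..π, φ (x - t) * g t) - T x)| := by congr 1; ring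
    _ ≤ _ := by rw [abs_mul]; exact mul_le_mul_of_nonneg_left (h x) (abs_nonneg c)

lemma PP_zero {n : ℕ} (φ : ℝ → ℝ) : PP n φ (fun _ => 0) 0 :=
  ⟨_, tp_zero n, fun x => by simp⟩

lemma PP_sum {n : ℕ} {φ : ℝ → ℝ} {ι : Type*} (s : Finset ι) (g : ι → ℝ → ℝ) (B : ι → ℝ)
    (hφ : Continuous φ) (hg : ∀ i, Continuous (g i)) (h : ∀ i ∈ s, PP n φ (g i) (B i)) :
    PP n φ (fun t => ∑ i ∈ s, g i t) (∑ i ∈ s, B i) := by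
  classical
  induction s using Finset.induction_on with
  | empty => simpa using PP_zero φ
  | insert i s hi ih =>
    simp only [Finset.sum_insert hi]
    exact PP_add hφ (hg i) (continuous_finsetSum _ fun j _ => hg j)
      (h i (Finset.mem_insert_self i s)) (ih fun j hj => h j (Finset.mem_insert_of_mem hj))

lemma PP_cos {n : ℕ} {φ : ℝ → ℝ} (hφ : Continuous φ) (hp : Function.Periodic φ (2 * π)) {k : ℤ}
    (hk : |k| < n) (θ : ℝ) : PP n φ (fun t => Real.cos (k * t - θ)) 0 := by
  have hV := tp_cos hk θ
  refine ⟨_, tp_smul (1 / π) (tp_conv hV hφ (-π) π), fun x => ?_⟩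
  rw [conv_flip hp (tp_per hV)]
  simp

lemma PP_sup {n : ℕ} {φ g : ℝ → ℝ} {M δ : ℝ} (hM : ∀ x, |φ x| ≤ M) (hδ : ∀ x, |g x| ≤ δ) :
    PP n φ g (2 * M * δ) := by
  refine ⟨_, tp_zero n, fun x => ?_⟩
  have hM0 : 0 ≤ M := (abs_nonneg _).trans (hM 0)
  have h := intervalIntegral.norm_integral_le_of_norm_le_const (a := -π) (b := π)
    (f := fun t => φ (x - t) * g t) (C := M * δ) (fun t _ => by
      rw [Real.norm_eq_abs, abs_mul]
      exact mul_le_mul (hM _) (hδ _) (abs_nonneg _) hM0)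
  rw [Real.norm_eq_abs] at h
  rw [sub_zero, abs_mul, abs_of_pos (by positivity : (0:ℝ) < 1 / π)]
  have e : |π - -π| = 2 * π := by rw [abs_of_pos] <;> linarith [Real.pi_pos]
  rw [e] at h
  calc _ ≤ 1 / π * (M * δ * (2 * π)) := mul_le_mul_of_nonneg_left h (by positivity)
    _ = _ := by field_simp

def Fej (m : ℕ) (t : ℝ) : ℝ :=
  (∑ p ∈ Finset.range m, Real.cos (p * t)) ^ 2 + (∑ p ∈ Finset.range m, Real.sin (p * t)) ^ 2

lemma fej_eq (m : ℕ) (t : ℝ) : Fej m t =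
    ∑ p ∈ Finset.range m, ∑ q ∈ Finset.range m, Real.cos (((p : ℝ) - q) * t) := by
  unfold Fej
  rw [sq, sq, Finset.sum_mul_sum, Finset.sum_mul_sum, ← Finset.sum_add_distrib]
  refine Finset.sum_congr rfl fun p _ => ?_
  rw [← Finset.sum_add_distrib]
  refine Finset.sum_congr rfl fun q _ => ?_
  rw [sub_mul, Real.cos_sub]

lemma fej_nonneg (m : ℕ) (t : ℝ) : 0 ≤ Fej m t := by unfold Fej; positivity

lemma fej_cont (m : ℕ) : Continuous (Fej m) := by unfold Fej; fun_prop

lemma fej_per (m : ℕ) : Function.Periodic (Fej m) (2 * π) := by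
  intro x
  unfold Fej
  have e : ∀ k : ℕ, (k:ℝ) * (x + 2 * π) = k * x + k * (2 * π) := fun k => by ring
  simp only [e, Real.cos_add_nat_mul_two_pi, Real.sin_add_nat_mul_two_pi]

lemma fej_le (m : ℕ) (t : ℝ) : Fej m t ≤ (m:ℝ) ^ 2 := by
  rw [fej_eq]
  calc _ ≤ ∑ p ∈ Finset.range m, ∑ q ∈ Finset.range m, (1:ℝ) :=
        Finset.sum_le_sum fun p _ => Finset.sum_le_sum fun q _ => Real.cos_le_one _
    _ = _ := by simp; ring

lemma geo1 (m : ℕ) (t : ℝ) :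
    (∑ p ∈ Finset.range m, Real.cos (p * t)) * (Real.cos t - 1) -
      (∑ p ∈ Finset.range m, Real.sin (p * t)) * Real.sin t = Real.cos (m * t) - 1 := by
  induction m with
  | zero => simp
  | succ m ih =>
    rw [Finset.sum_range_succ, Finset.sum_range_succ]
    push_cast
    have e : ((m:ℝ) + 1) * t = m * t + t := by ring
    rw [e, Real.cos_add]
    linarith

lemma geo2 (m : ℕ) (t : ℝ) :
    (∑ p ∈ Finset.range m, Real.cos (p * t)) * Real.sin t +
      (∑ p ∈ Finset.range m, Real.sin (p * t)) * (Real.cos t - 1) = Real.sin (m * t) := by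
  induction m with
  | zero => simp
  | succ m ih =>
    rw [Finset.sum_range_succ, Finset.sum_range_succ]
    push_cast
    have e : ((m:ℝ) + 1) * t = m * t + t := by ring
    rw [e, Real.sin_add]
    linarith

lemma fej_mul (m : ℕ) (t : ℝ) : Fej m t * (2 - 2 * Real.cos t) = 2 - 2 * Real.cos (m * t) := by
  have h1 := geo1 m t
  have h2 := geo2 m t
  unfold Fej
  set A := ∑ p ∈ Finset.range m, Real.cos (p * t)
  set B := ∑ p ∈ Finset.range m, Real.sin (p * t)
  have e1 := Real.sin_sq_add_cos_sq t
  have e2 := Real.sin_sq_add_cos_sq (m * t)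
  have h3 : (A * (Real.cos t - 1) - B * Real.sin t) ^ 2 +
      (A * Real.sin t + B * (Real.cos t - 1)) ^ 2 = (Real.cos (m * t) - 1) ^ 2 +
      Real.sin (m * t) ^ 2 := by rw [h1, h2]
  have h4 : (A * (Real.cos t - 1) - B * Real.sin t) ^ 2 +
      (A * Real.sin t + B * (Real.cos t - 1)) ^ 2 =
      (A ^ 2 + B ^ 2) * ((Real.sin t ^ 2 + Real.cos t ^ 2) + 1 - 2 * Real.cos t) := by ring
  rw [h4, e1] at h3
  linarith

lemma fej_decay (m : ℕ) (t : ℝ) (ht : |t| ≤ π) : Fej m t * t ^ 2 ≤ π ^ 2 := by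
  have h1 := fej_mul m t
  have h2 := Real.cos_le_one_sub_mul_cos_sq ht
  have h3 := fej_nonneg m t
  have h4 := Real.neg_one_le_cos (m * t)
  have h5 : Fej m t * (4 / π ^ 2 * t ^ 2) ≤ Fej m t * (2 - 2 * Real.cos t) := by
    refine mul_le_mul_of_nonneg_left ?_ h3
    have : 4 / π ^ 2 * t ^ 2 = 2 * (2 / π ^ 2 * t ^ 2) := by ring
    linarith
  have h6 : Fej m t * (4 / π ^ 2 * t ^ 2) ≤ 4 := by linarith
  have hp : 0 < π ^ 2 := by positivity
  have e : Fej m t * t ^ 2 = (Fej m t * (4 / π ^ 2 * t ^ 2)) * (π ^ 2 / 4) := by field_simp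
  rw [e]
  nlinarith

lemma fej_bound (m : ℕ) (t : ℝ) (ht : |t| ≤ π) :
    Fej m t * (1 + (m * t) ^ 2) ≤ 11 * (m:ℝ) ^ 2 := by
  have h1 := fej_decay m t ht
  have h2 := fej_le m t
  have h3 : π ^ 2 ≤ 10 := by nlinarith [Real.pi_lt_d2, Real.pi_pos]
  have : Fej m t * (1 + (m * t) ^ 2) = Fej m t + (m:ℝ) ^ 2 * (Fej m t * t ^ 2) := by ring
  rw [this]
  have := mul_le_mul_of_nonneg_left (h1.trans h3) (sq_nonneg (m:ℝ))
  linarith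

lemma fej_sq_tp (m n : ℕ) (h : 2 * m ≤ n + 1) (hn : 0 < n) :
    IsTrigPoly n (fun t => Fej m t ^ 2) := by
  have e : (fun t => Fej m t ^ 2) = fun t => ∑ p ∈ Finset.range m, ∑ q ∈ Finset.range m,
      ∑ r ∈ Finset.range m, ∑ s ∈ Finset.range m,
      ((1/2) * Real.cos ((((p : ℤ) - q + r - s : ℤ) : ℝ) * t - 0) +
       (1/2) * Real.cos ((((p : ℤ) - q - r + s : ℤ) : ℝ) * t - 0)) := by
    funext t
    rw [fej_eq, sq, Finset.sum_mul]
    refine Finset.sum_congr rfl fun p _ => ?_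
    rw [Finset.sum_mul]
    refine Finset.sum_congr rfl fun q _ => ?_
    rw [Finset.mul_sum]
    refine Finset.sum_congr rfl fun r _ => ?_
    rw [Finset.mul_sum]
    refine Finset.sum_congr rfl fun s _ => ?_
    have e1 : (((p : ℤ) - q + r - s : ℤ) : ℝ) * t - 0 = ((p:ℝ) - q) * t + ((r:ℝ) - s) * t := by
      push_cast; ring
    have e2 : (((p : ℤ) - q - r + s : ℤ) : ℝ) * t - 0 = ((p:ℝ) - q) * t - ((r:ℝ) - s) * t := by
      push_cast; ring
    rw [e1, e2, Real.cos_add, Real.cos_sub]; ring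
  rw [e]
  refine tp_sum _ _ fun p hp => tp_sum _ _ fun q hq => tp_sum _ _ fun r hr =>
    tp_sum _ _ fun s hs => ?_
  simp only [Finset.mem_range] at hp hq hr hs
  refine tp_add (tp_smul _ (tp_cos ?_ 0)) (tp_smul _ (tp_cos ?_ 0)) <;>
  · rw [abs_lt]; omega

lemma jackson_upper (m n : ℕ) (hm : 0 < m) (hn : n ≤ 2 * m) :
    ∫ t in (-π)..π, Fej m t ^ 2 * (1 + n * |t|) ≤ 484 * π * m ^ 3 := by
  have hm' : (0:ℝ) < m := by exact_mod_cast hm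
  have hn' : (n:ℝ) ≤ 2 * m := by exact_mod_cast hn
  have hc := fej_cont m
  have h1 : ∫ t in (-π)..π, Fej m t ^ 2 * (1 + n * |t|) ≤
      ∫ t in (-π)..π, 484 * (m:ℝ) ^ 4 * (1 + (m * t) ^ 2)⁻¹ := by
    refine intervalIntegral.integral_mono_on (by linarith [Real.pi_pos]) ?_ ?_ ?_
    · exact Continuous.intervalIntegrable (by fun_prop) _ _
    · refine Continuous.intervalIntegrable ?_ _ _
      refine Continuous.mul (by fun_prop) (Continuous.inv₀ (by fun_prop) fun t => by positivity)
    · intro t ht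
      have hb := fej_bound m t (abs_le.2 ht)
      have h0 := fej_nonneg m t
      have hpos : 0 < 1 + (m * t) ^ 2 := by positivity
      rw [← div_eq_mul_inv, le_div_iff₀ hpos]
      have h2 : 1 + n * |t| ≤ 4 * (1 + (m * t) ^ 2) := by
        have : (n:ℝ) * |t| ≤ 2 * m * |t| := mul_le_mul_of_nonneg_right hn' (abs_nonneg t)
        have e : (m * t) ^ 2 = (m * |t|) ^ 2 := by rw [mul_pow, mul_pow, sq_abs]
        rw [e]
        nlinarith [sq_nonneg (m * |t| - 1)]
      calc _ ≤ Fej m t ^ 2 * (4 * (1 + (m * t) ^ 2)) * (1 + (m * t) ^ 2) := by gcongr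
        _ = 4 * (Fej m t * (1 + (m * t) ^ 2)) ^ 2 := by ring
        _ ≤ 4 * (11 * (m:ℝ) ^ 2) ^ 2 := by gcongr
        _ = _ := by ring
  have h2 : ∫ t in (-π)..π, 484 * (m:ℝ) ^ 4 * (1 + (m * t) ^ 2)⁻¹ ≤ 484 * π * m ^ 3 := by
    rw [intervalIntegral.integral_const_mul]
    have h3 := intervalIntegral.integral_comp_mul_left (a := -π) (b := π)
      (fun x : ℝ => (1 + x ^ 2)⁻¹) (c := (m:ℝ)) hm'.ne'
    rw [h3, integral_inv_one_add_sq, smul_eq_mul]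
    have h4 := Real.arctan_lt_pi_div_two (m * π)
    have h5 := Real.neg_pi_div_two_lt_arctan (m * -π)
    have h6 : arctan (m * π) - arctan (m * -π) ≤ π := by linarith
    calc 484 * (m:ℝ) ^ 4 * ((m:ℝ)⁻¹ * (arctan (m * π) - arctan (m * -π))) ≤
        484 * (m:ℝ) ^ 4 * ((m:ℝ)⁻¹ * π) := by gcongr
      _ = _ := by field_simp
  exact h1.trans h2

lemma jackson_lower (m : ℕ) (hm : 0 < m) :
    (m:ℝ) ^ 3 / 8 ≤ ∫ t in (-π)..π, Fej m t ^ 2 := by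
  have hm' : (1:ℝ) ≤ m := by exact_mod_cast hm
  have hc := fej_cont m
  have hinv : (1:ℝ) / m ≤ 1 := by rw [div_le_one (by linarith)]; exact hm'
  have hinv0 : (0:ℝ) < 1 / m := by positivity
  have h1 : ∫ t in (-(1 / (m:ℝ)))..(1 / (m:ℝ)), Fej m t ^ 2 ≤ ∫ t in (-π)..π, Fej m t ^ 2 := by
    refine intervalIntegral.integral_mono_interval ?_ ?_ ?_ ?_ ?_
    · linarith [Real.pi_gt_three]
    · linarith
    · linarith [Real.pi_gt_three]
    · exact Eventually.of_forall fun t => by positivity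
    · exact Continuous.intervalIntegrable (by fun_prop) _ _
  refine le_trans ?_ h1
  have h2 : ∫ t in (-(1 / (m:ℝ)))..(1 / (m:ℝ)), (m:ℝ) ^ 4 / 16 ≤
      ∫ t in (-(1 / (m:ℝ)))..(1 / (m:ℝ)), Fej m t ^ 2 := by
    refine intervalIntegral.integral_mono_on (by linarith) ?_ ?_ ?_
    · exact Continuous.intervalIntegrable (by fun_prop) _ _
    · exact Continuous.intervalIntegrable (by fun_prop) _ _
    · intro t ht
      have ht' : |t| ≤ 1 / m := abs_le.2 ht
      have hA : (m:ℝ) / 2 ≤ ∑ p ∈ Finset.range m, Real.cos (p * t) := by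
        calc (m:ℝ) / 2 = ∑ p ∈ Finset.range m, (1/2:ℝ) := by simp; ring
          _ ≤ _ := by
            refine Finset.sum_le_sum fun p hp => ?_
            have hp' : (p:ℝ) ≤ m := by exact_mod_cast (Finset.mem_range.1 hp).le
            have h3 := Real.one_sub_sq_div_two_le_cos (x := p * t)
            have h4 : |(p:ℝ) * t| ≤ 1 := by
              rw [abs_mul, Nat.abs_cast]
              calc (p:ℝ) * |t| ≤ m * (1 / m) := by gcongr
                _ = 1 := by field_simp
            have h5 : ((p:ℝ) * t) ^ 2 ≤ 1 := (sq_le_one_iff_abs_le_one _).2 h4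
            linarith
      have hF : (m:ℝ) ^ 2 / 4 ≤ Fej m t := by
        unfold Fej
        have : ((m:ℝ) / 2) ^ 2 ≤ (∑ p ∈ Finset.range m, Real.cos (p * t)) ^ 2 := by gcongr
        nlinarith [sq_nonneg (∑ p ∈ Finset.range m, Real.sin (p * t))]
      calc (m:ℝ) ^ 4 / 16 = ((m:ℝ) ^ 2 / 4) ^ 2 := by ring
        _ ≤ _ := by gcongr
  refine le_trans (le_of_eq ?_) h2
  rw [intervalIntegral.integral_const, smul_eq_mul]
  field_simp
  ring

lemma mod_nmul {ω : ℝ → ℝ} (hω : IsModulus ω) (k : ℕ) {u : ℝ} (hu : 0 ≤ u) :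
    ω (k * u) ≤ k * ω u := by
  obtain ⟨_, _, h3, h4, _⟩ := hω
  induction k with
  | zero => simp [h4]
  | succ k ih =>
    have := h3 (k * u) u (by positivity) hu
    push_cast
    rw [add_mul, one_mul, add_mul, one_mul]
    linarith

lemma mod_bound {ω : ℝ → ℝ} (hω : IsModulus ω) (n : ℕ) (hn : 0 < n) {s : ℝ} (hs : 0 ≤ s) :
    ω s ≤ (1 + n * s) * ω (1 / n) := by
  have hn' : (0:ℝ) < n := by exact_mod_cast hn
  have h1 : s ≤ (⌈n * s⌉₊ : ℝ) * (1 / n) := by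
    have := Nat.le_ceil (n * s)
    rw [mul_one_div, le_div_iff₀ hn']; linarith
  have h2 : ω s ≤ ω ((⌈n * s⌉₊ : ℝ) * (1 / n)) :=
    hω.2.1 hs (hs.trans h1) h1
  have h3 := mod_nmul hω ⌈n * s⌉₊ (u := 1 / (n:ℝ)) (by positivity)
  have h4 : (⌈n * s⌉₊ : ℝ) ≤ 1 + n * s := by
    have := Nat.ceil_lt_add_one (a := n * s) (by positivity); linarith
  have h5 := hω.2.2.2.2 (1 / (n:ℝ)) (by positivity)
  exact h2.trans (h3.trans (mul_le_mul_of_nonneg_right h4 h5))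

theorem jackson {ω : ℝ → ℝ} (hω : IsModulus ω) {φ : ℝ → ℝ} (hφ : Continuous φ)
    (hp : Function.Periodic φ (2 * π))
    (hm : ∀ t : ℝ, 0 ≤ t → ∀ x h : ℝ, |h| ≤ t → |φ (x + h) - φ x| ≤ ω t)
    (n : ℕ) (hn : 0 < n) :
    ∃ V, IsTrigPoly n V ∧ ∀ x, |φ x - V x| ≤ 3872 * π * ω (1 / n) := by
  set m := (n + 1) / 2 with hmdef
  have hm0 : 0 < m := by omega
  have hm0' : (0:ℝ) < m := by exact_mod_cast hm0
  have hc := fej_cont m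
  have hV := fej_sq_tp m n (by omega) hn
  have hl := jackson_lower m hm0
  set I := ∫ t in (-π)..π, Fej m t ^ 2 with hI
  have hI0 : 0 < I := lt_of_lt_of_le (by positivity) hl
  refine ⟨_, tp_smul (1 / I) (tp_conv hV hφ (-π) π), fun x => ?_⟩
  have hF := conv_flip (g := φ) (tp_per hV) hp x
  rw [hF]
  have e : φ x - 1 / I * (∫ t in (-π)..π, φ (x - t) * Fej m t ^ 2) =
      (1 / I) * ∫ t in (-π)..π, (φ x - φ (x - t)) * Fej m t ^ 2 := by
    have : ∫ t in (-π)..π, (φ x - φ (x - t)) * Fej m t ^ 2 =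
        φ x * I - ∫ t in (-π)..π, φ (x - t) * Fej m t ^ 2 := by
      rw [hI, ← intervalIntegral.integral_const_mul, ← intervalIntegral.integral_sub]
      · simp only [sub_mul]
      · exact Continuous.intervalIntegrable (by fun_prop) _ _
      · exact Continuous.intervalIntegrable (by fun_prop) _ _
    rw [this]; field_simp
  rw [e, abs_mul, abs_of_pos (by positivity : 0 < 1 / I)]
  have hw := hω.2.2.2.2 (1 / (n:ℝ)) (by positivity)
  have h1 : |∫ t in (-π)..π, (φ x - φ (x - t)) * Fej m t ^ 2| ≤
      ∫ t in (-π)..π, ω (1 / n) * (Fej m t ^ 2 * (1 + n * |t|)) := by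
    rw [← Real.norm_eq_abs]
    refine intervalIntegral.norm_integral_le_of_norm_le (by linarith [Real.pi_pos]) ?_ ?_
    · refine Eventually.of_forall fun t _ => ?_
      rw [Real.norm_eq_abs, abs_mul, abs_of_nonneg (by positivity : 0 ≤ Fej m t ^ 2)]
      have h2 := hm |t| (abs_nonneg t) x (-t) (by rw [abs_neg])
      rw [← sub_eq_add_neg, abs_sub_comm] at h2
      have h3 := h2.trans (mod_bound hω n hn (abs_nonneg t))
      calc _ ≤ (1 + n * |t|) * ω (1 / n) * Fej m t ^ 2 := by gcongr
        _ = _ := by ring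
    · exact Continuous.intervalIntegrable (by fun_prop) _ _
  rw [intervalIntegral.integral_const_mul] at h1
  have h2 := jackson_upper m n hm0 (by omega)
  calc _ ≤ 1 / I * (ω (1 / n) * (484 * π * m ^ 3)) := by gcongr; exact h1.trans (by gcongr)
    _ ≤ 1 / (m ^ 3 / 8) * (ω (1 / n) * (484 * π * m ^ 3)) := by gcongr
    _ = _ := by field_simp; ring

def HC (ω φ : ℝ → ℝ) : Prop := IsModulus ω ∧ Continuous φ ∧ Function.Periodic φ (2 * π) ∧
  ∀ t : ℝ, 0 ≤ t → ∀ x h : ℝ, |h| ≤ t → |φ (x + h) - φ x| ≤ ω t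

lemma PP_L1 {ω φ : ℝ → ℝ} (h : HC ω φ) {n : ℕ} (hn : 0 < n) {g : ℝ → ℝ} (hg : Continuous g) :
    PP n φ g (3872 * ω (1 / n) * ∫ t in (-π)..π, |g t|) := by
  obtain ⟨hω, hφ, hp, hm⟩ := h
  obtain ⟨V, hV, hb⟩ := jackson hω hφ hp hm n hn
  have hVc := tp_cont hV
  refine ⟨_, tp_smul (1 / π) (tp_conv hV hg (-π) π), fun x => ?_⟩
  rw [← mul_sub, ← intervalIntegral.integral_sub, abs_mul,
    abs_of_pos (by positivity : (0:ℝ) < 1 / π)]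
  · have h1 : |∫ t in (-π)..π, (φ (x - t) * g t - V (x - t) * g t)| ≤
        ∫ t in (-π)..π, (3872 * π * ω (1 / n)) * |g t| := by
      rw [← Real.norm_eq_abs]
      refine intervalIntegral.norm_integral_le_of_norm_le (by linarith [Real.pi_pos]) ?_ ?_
      · refine Eventually.of_forall fun t _ => ?_
        rw [← sub_mul, Real.norm_eq_abs, abs_mul]
        exact mul_le_mul_of_nonneg_right (hb _) (abs_nonneg _)
      · exact Continuous.intervalIntegrable (by fun_prop) _ _
    rw [intervalIntegral.integral_const_mul] at h1
    calc _ ≤ 1 / π * ((3872 * π * ω (1 / n)) * ∫ t in (-π)..π, |g t|) :=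
          mul_le_mul_of_nonneg_left h1 (by positivity)
      _ = _ := by field_simp
  · exact Continuous.intervalIntegrable (by fun_prop) _ _
  · exact Continuous.intervalIntegrable (by fun_prop) _ _

lemma sym_int {h : ℝ → ℝ} (hh : Continuous h) (d : ℝ) :
    ∫ u in (-d)..d, h u = ∫ u in (0:ℝ)..d, (h u + h (-u)) := by
  rw [intervalIntegral.integral_add (Continuous.intervalIntegrable (by fun_prop) _ _)
    (Continuous.intervalIntegrable (by fun_prop) _ _)]
  have := intervalIntegral.integral_comp_neg (a := 0) (b := d) h
  rw [this, neg_zero, add_comm]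
  exact (intervalIntegral.integral_add_adjacent_intervals
    (Continuous.intervalIntegrable (by fun_prop) _ _)
    (Continuous.intervalIntegrable (by fun_prop) _ _)).symm

lemma omega_int {ω : ℝ → ℝ} (hω : IsModulus ω) (n : ℕ) (hn : 0 < n) :
    IntervalIntegrable (fun u => ω (2 * (n * u) / n) * Real.sin (n * u)) volume
      0 (π / (2 * n)) := by
  have hn' : (0:ℝ) < n := by exact_mod_cast hn
  apply ContinuousOn.intervalIntegrable
  have hd : 0 ≤ π / (2 * n) := by positivity
  rw [Set.uIcc_of_le hd]
  refine ContinuousOn.mul ?_ (by fun_prop)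
  refine hω.1.comp (by fun_prop) ?_
  intro u hu
  have := hu.1
  simp only [Set.mem_Ici]; positivity

lemma eN_sub (ω : ℝ → ℝ) (n : ℕ) (hn : 0 < n) :
    ∫ u in (0:ℝ)..(π / (2 * n)), ω (2 * (n * u) / n) * Real.sin (n * u) = eN n ω / n := by
  have hn' : (0:ℝ) < n := by exact_mod_cast hn
  have := intervalIntegral.integral_comp_mul_left (a := 0) (b := π / (2 * n))
      (fun t : ℝ => ω (2 * t / n) * Real.sin t) (c := (n:ℝ)) hn'.ne'
  rw [this, smul_eq_mul, mul_zero]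
  have e : (n:ℝ) * (π / (2 * n)) = π / 2 := by field_simp
  rw [e]
  unfold eN
  field_simp

lemma half_wave {ω φ : ℝ → ℝ} (h : HC ω φ) {n : ℕ} (hn : 0 < n) (θ x : ℝ) (l : ℕ) :
    |∫ t in ((θ + l * π) / n)..((θ + (l + 1 : ℕ) * π) / n), φ (x - t) * Real.cos (n * t - θ)|
      ≤ eN n ω / n := by
  obtain ⟨hω, hφ, hp, hm⟩ := h
  have hn' : (0:ℝ) < n := by exact_mod_cast hn
  set d := π / (2 * n) with hd
  set c := (θ + l * π + π / 2) / n with hc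
  have e1 : (θ + l * π) / n = -d + c := by rw [hd, hc]; field_simp; ring
  have e2 : (θ + (l + 1 : ℕ) * π) / n = d + c := by rw [hd, hc]; push_cast; field_simp; ring
  rw [e1, e2, ← intervalIntegral.integral_comp_add_right
    (fun t => φ (x - t) * Real.cos (n * t - θ)) c, sym_int (by fun_prop)]
  rw [← eN_sub ω n hn, ← Real.norm_eq_abs]
  have hd0 : 0 ≤ d := by positivity
  refine intervalIntegral.norm_integral_le_of_norm_le hd0 ?_ (omega_int hω n hn)
  refine Eventually.of_forall fun u hu => ?_
  have hu0 : 0 ≤ u := hu.1.le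
  have c1 : ∀ v : ℝ, Real.cos (n * (v + c) - θ) = Real.cos (l * π) * -Real.sin (n * v) := by
    intro v
    have : n * (v + c) - θ = l * π + (n * v + π / 2) := by rw [hc]; field_simp; ring
    rw [this, Real.cos_add, Real.sin_nat_mul_pi, Real.cos_add_pi_div_two]; ring
  rw [c1, c1]
  have hs : 0 ≤ Real.sin (n * u) := by
    apply Real.sin_nonneg_of_nonneg_of_le_pi (by positivity)
    have : (n:ℝ) * u ≤ n * d := by gcongr; exact hu.2
    have e : (n:ℝ) * d = π / 2 := by rw [hd]; field_simp
    linarith [Real.pi_pos]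
  have e : φ (x - (u + c)) * (Real.cos (l * π) * -Real.sin (n * u)) +
      φ (x - (-u + c)) * (Real.cos (l * π) * -Real.sin (n * -u)) =
      (φ ((x - (u + c)) + 2 * u) - φ (x - (u + c))) * Real.cos (l * π) * Real.sin (n * u) := by
    have : x - (u + c) + 2 * u = x - (-u + c) := by ring
    rw [this, mul_neg (n:ℝ) u, Real.sin_neg]; ring
  rw [e, Real.norm_eq_abs, abs_mul, abs_mul, abs_of_nonneg hs]
  have h1 := hm (2 * u) (by positivity) (x - (u + c)) (2 * u) (by rw [abs_of_nonneg]; positivity)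
  have e3 : 2 * (n * u) / n = 2 * u := by field_simp
  rw [e3]
  have h2 := Real.abs_cos_le_one (l * π)
  gcongr
  calc _ ≤ ω (2 * u) * 1 := by gcongr; exact (abs_nonneg _).trans h1
    _ = _ := mul_one _

lemma split_int {g : ℝ → ℝ} (hg : Continuous g) (hp : Function.Periodic g (2 * π)) {n : ℕ}
    (hn : 0 < n) (θ : ℝ) :
    ∫ t in (-π)..π, g t = ∑ l ∈ Finset.range (2 * n),
      ∫ t in ((θ + l * π) / n)..((θ + (l + 1 : ℕ) * π) / n), g t := by
  have hn' : (0:ℝ) < n := by exact_mod_cast hn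
  rw [intervalIntegral.sum_integral_adjacent_intervals (a := fun l : ℕ => (θ + l * π) / n)
    (fun k _ => hg.intervalIntegrable _ _)]
  have h2 := hp.intervalIntegral_add_eq (-π) (θ / n)
  have e2 : -π + 2 * π = π := by ring
  rw [e2] at h2
  rw [h2]
  congr 1
  · simp
  · push_cast; field_simp

lemma PP_main {ω φ : ℝ → ℝ} (h : HC ω φ) {n : ℕ} (hn : 0 < n) (θ : ℝ) {F F' : ℝ → ℝ}
    (hF : ∀ t, HasDerivAt F (F' t) t) (hF' : Continuous F') (hFp : Function.Periodic F (2 * π))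
    (hFp' : Function.Periodic F' (2 * π)) (hF0 : ∀ t, 0 ≤ F t) :
    PP n φ (fun t => Real.cos (n * t - θ) * F t)
      ((1 / π) * (eN n ω / π * ∫ t in (-π)..π, F t) +
        3872 * ω (1 / n) * (π / n) * ∫ t in (-π)..π, |F' t|) := by
  have hn' : (0:ℝ) < n := by exact_mod_cast hn
  have hFc : Continuous F := continuous_iff_continuousAt.2 fun t => (hF t).continuousAt
  have hH := h
  obtain ⟨hω, hφ, hp, hm⟩ := h
  obtain ⟨V, hV, hb⟩ := jackson hω hφ hp hm n hn
  have hVc := tp_cont hV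
  set tt : ℕ → ℝ := fun l => (θ + l * π) / n with htt
  have hle : ∀ l, tt l ≤ tt (l + 1) := by
    intro l; simp only [htt]; push_cast; gcongr; linarith
  have hlen : ∀ l, tt (l + 1) - tt l = π / n := by
    intro l; simp only [htt]; push_cast; field_simp; ring
  set a : ℕ → ℝ := fun l => n / π * ∫ t in (tt l)..(tt (l + 1)), F t with ha
  have ha0 : ∀ l, 0 ≤ a l := fun l => mul_nonneg (by positivity)
    (intervalIntegral.integral_nonneg (hle l) fun t _ => hF0 t)
  set v : ℕ → ℝ := fun l => ∫ t in (tt l)..(tt (l + 1)), |F' t| with hv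
  have hav : ∀ l, ∀ t ∈ Set.Icc (tt l) (tt (l + 1)), |F t - a l| ≤ v l := by
    intro l t ht
    have h1 : F t - a l = n / π * ∫ s in (tt l)..(tt (l + 1)), (F t - F s) := by
      rw [intervalIntegral.integral_sub (by simp) (hFc.intervalIntegrable _ _),
        intervalIntegral.integral_const, hlen, smul_eq_mul, mul_sub]
      simp only [ha]; field_simp
    have h2 : |∫ s in (tt l)..(tt (l + 1)), (F t - F s)| ≤ v l * (π / n) := by
      have := intervalIntegral.norm_integral_le_of_norm_le_const (a := tt l) (b := tt (l + 1))
        (f := fun s => F t - F s) (C := v l) ?_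
      · rwa [Real.norm_eq_abs, hlen, abs_of_pos (by positivity : (0:ℝ) < π / n)] at this
      · intro s hs
        rw [Set.uIoc_of_le (hle l)] at hs
        have e : F t - F s = ∫ u in s..t, F' u :=
          (intervalIntegral.integral_eq_sub_of_hasDerivAt (fun u _ => hF u)
            (hF'.intervalIntegrable _ _)).symm
        rw [e]
        refine intervalIntegral.norm_integral_le_integral_norm_uIoc.trans ?_
        simp only [hv, Real.norm_eq_abs]
        rw [intervalIntegral.integral_of_le (hle l)]
        refine setIntegral_mono_set ?_ ?_ ?_
        · exact (intervalIntegrable_iff_integrableOn_Ioc_of_le (hle l)).1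
            (hF'.abs.intervalIntegrable _ _)
        · exact Eventually.of_forall fun u => abs_nonneg _
        · apply LE.le.eventuallyLE
          rw [Set.uIoc]
          apply Set.Ioc_subset_Ioc
          · exact le_min hs.1.le ht.1
          · exact max_le hs.2 ht.2
    rw [h1, abs_mul, abs_of_pos (by positivity : (0:ℝ) < n / π)]
    calc _ ≤ n / π * (v l * (π / n)) := by gcongr
      _ = _ := by field_simp
  refine ⟨_, tp_smul (1 / π) (tp_sum (Finset.range (2 * n)) (fun l x =>
    ∫ t in (tt l)..(tt (l + 1)), V (x - t) * (Real.cos (n * t - θ) * (F t - a l)))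
    fun l _ => tp_conv hV (by fun_prop) _ _), fun x => ?_⟩
  have hcp : Function.Periodic (fun t => φ (x - t) * (Real.cos (n * t - θ) * F t)) (2 * π) := by
    intro t
    have e1 : x - (t + 2 * π) = (x - t) - 2 * π := by ring
    have e2 : n * (t + 2 * π) - θ = (n * t - θ) + n * (2 * π) := by ring
    simp only [hFp t, e1, e2, hp.sub_eq, Real.cos_add_nat_mul_two_pi]
  rw [split_int (by fun_prop) hcp hn θ, ← mul_sub, ← Finset.sum_sub_distrib, abs_mul,
    abs_of_pos (by positivity : (0:ℝ) < 1 / π)]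
  have key : ∀ l ∈ Finset.range (2 * n),
      |(∫ t in (tt l)..(tt (l + 1)), φ (x - t) * (Real.cos (n * t - θ) * F t)) -
        ∫ t in (tt l)..(tt (l + 1)), V (x - t) * (Real.cos (n * t - θ) * (F t - a l))| ≤
      eN n ω / π * (∫ t in (tt l)..(tt (l + 1)), F t) + 3872 * π * ω (1 / n) * (π / n) * v l := by
    intro l _
    have e : (∫ t in (tt l)..(tt (l + 1)), φ (x - t) * (Real.cos (n * t - θ) * F t)) -
        (∫ t in (tt l)..(tt (l + 1)), V (x - t) * (Real.cos (n * t - θ) * (F t - a l))) =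
        a l * (∫ t in (tt l)..(tt (l + 1)), φ (x - t) * Real.cos (n * t - θ)) +
        ∫ t in (tt l)..(tt (l + 1)),
          (φ (x - t) - V (x - t)) * (Real.cos (n * t - θ) * (F t - a l)) := by
      rw [← intervalIntegral.integral_const_mul, ← intervalIntegral.integral_sub,
        ← intervalIntegral.integral_add]
      · refine intervalIntegral.integral_congr fun t _ => ?_
        ring
      all_goals exact Continuous.intervalIntegrable (by fun_prop) _ _
    rw [e]
    refine (abs_add_le _ _).trans (add_le_add ?_ ?_)
    · rw [abs_mul, abs_of_nonneg (ha0 l)]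
      calc _ ≤ a l * (eN n ω / n) :=
            mul_le_mul_of_nonneg_left (half_wave hH hn θ x l) (ha0 l)
        _ = _ := by simp only [ha]; field_simp
    · have := intervalIntegral.norm_integral_le_of_norm_le_const (a := tt l) (b := tt (l + 1))
        (f := fun t => (φ (x - t) - V (x - t)) * (Real.cos (n * t - θ) * (F t - a l)))
        (C := 3872 * π * ω (1 / n) * v l) ?_
      · rw [Real.norm_eq_abs, hlen, abs_of_pos (by positivity : (0:ℝ) < π / n)] at this
        refine this.trans (le_of_eq (by ring))
      · intro t ht
        rw [Set.uIoc_of_le (hle l)] at ht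
        have h1 := hav l t ⟨ht.1.le, ht.2⟩
        have h2 := hb (x - t)
        have h3 := Real.abs_cos_le_one (n * t - θ)
        rw [Real.norm_eq_abs, abs_mul, abs_mul]
        refine mul_le_mul h2 ?_ (by positivity) ((abs_nonneg _).trans h2)
        calc _ ≤ 1 * |F t - a l| := by gcongr
          _ ≤ _ := by rw [one_mul]; exact h1
  calc _ ≤ 1 / π * ∑ l ∈ Finset.range (2 * n),
      (eN n ω / π * (∫ t in (tt l)..(tt (l + 1)), F t) +
        3872 * π * ω (1 / n) * (π / n) * v l) :=
        mul_le_mul_of_nonneg_left ((Finset.abs_sum_le_sum_abs _ _).trans (Finset.sum_le_sum key))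
          (by positivity)
    _ = 1 / π * (eN n ω / π * (∫ t in (-π)..π, F t) +
        3872 * π * ω (1 / n) * (π / n) * ∫ t in (-π)..π, |F' t|) := by
        rw [split_int hFc hFp hn θ, split_int hF'.abs
          (fun t => by simp only [hFp' t]) hn θ, Finset.sum_add_distrib, Finset.mul_sum,
          Finset.mul_sum]
    _ = _ := by field_simp

lemma int_cos (k : ℤ) : ∫ t in (-π)..π, Real.cos (k * t) = if k = 0 then 2 * π else 0 := by
  split_ifs with h
  · subst h; simp; ring
  · have hk : (k:ℝ) ≠ 0 := by exact_mod_cast h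
    rw [intervalIntegral.integral_comp_mul_left (fun x => Real.cos x) hk, integral_cos]
    rw [mul_neg, Real.sin_neg, Real.sin_int_mul_pi]; simp

lemma int_quad (m : ℕ) (w : ℕ → ℝ) :
    ∫ t in (-π)..π, ((∑ p ∈ Finset.range m, w p * Real.cos (p * t)) ^ 2 +
      (∑ p ∈ Finset.range m, w p * Real.sin (p * t)) ^ 2) =
    2 * π * ∑ p ∈ Finset.range m, w p ^ 2 := by
  have e : ∀ t : ℝ, ((∑ p ∈ Finset.range m, w p * Real.cos (p * t)) ^ 2 +
      (∑ p ∈ Finset.range m, w p * Real.sin (p * t)) ^ 2) =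
      ∑ p ∈ Finset.range m, ∑ q ∈ Finset.range m,
        w p * w q * Real.cos (((p - q : ℤ) : ℝ) * t) := by
    intro t
    rw [sq, sq, Finset.sum_mul_sum, Finset.sum_mul_sum, ← Finset.sum_add_distrib]
    refine Finset.sum_congr rfl fun p _ => ?_
    rw [← Finset.sum_add_distrib]
    refine Finset.sum_congr rfl fun q _ => ?_
    push_cast
    rw [sub_mul, Real.cos_sub]; ring
  simp only [e]
  rw [intervalIntegral.integral_finsetSum
    (fun p _ => Continuous.intervalIntegrable (by fun_prop) _ _), Finset.mul_sum]
  refine Finset.sum_congr rfl fun p hp => ?_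
  rw [intervalIntegral.integral_finsetSum
    (fun p _ => Continuous.intervalIntegrable (by fun_prop) _ _)]
  rw [Finset.sum_eq_single p]
  · rw [intervalIntegral.integral_const_mul, int_cos]; simp; ring
  · intro q _ hq
    rw [intervalIntegral.integral_const_mul, int_cos, if_neg (by omega)]; simp
  · intro h; exact absurd hp h

lemma fej_int (m : ℕ) : ∫ t in (-π)..π, Fej m t = 2 * π * m := by
  have := int_quad m (fun _ => 1)
  simpa [Fej] using this

def FejD (m : ℕ) (t : ℝ) : ℝ :=
  2 * (∑ p ∈ Finset.range m, Real.cos (p * t)) * -(∑ p ∈ Finset.range m, p * Real.sin (p * t)) +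
  2 * (∑ p ∈ Finset.range m, Real.sin (p * t)) * (∑ p ∈ Finset.range m, p * Real.cos (p * t))

lemma fej_deriv (m : ℕ) (t : ℝ) : HasDerivAt (Fej m) (FejD m t) t := by
  have h0 : ∀ p : ℕ, HasDerivAt (fun t : ℝ => (p:ℝ) * t) p t := fun p => by
    simpa using (hasDerivAt_id t).const_mul (p:ℝ)
  have hA : HasDerivAt (fun t : ℝ => ∑ p ∈ Finset.range m, Real.cos (p * t))
      (∑ p ∈ Finset.range m, (-Real.sin (p * t) * p)) t :=
    HasDerivAt.fun_sum fun p _ => (h0 p).cos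
  have hB : HasDerivAt (fun t : ℝ => ∑ p ∈ Finset.range m, Real.sin (p * t))
      (∑ p ∈ Finset.range m, (Real.cos (p * t) * p)) t :=
    HasDerivAt.fun_sum fun p _ => (h0 p).sin
  have h := (hA.pow 2).add (hB.pow 2)
  refine h.congr_deriv ?_
  unfold FejD
  rw [← Finset.sum_neg_distrib]
  have e1 : ∀ p ∈ Finset.range m, -Real.sin (p * t) * p = -(p * Real.sin (p * t)) :=
    fun p _ => by ring
  have e2 : ∀ p ∈ Finset.range m, Real.cos (p * t) * p = p * Real.cos (p * t) :=
    fun p _ => by ring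
  rw [Finset.sum_congr rfl e1, Finset.sum_congr rfl e2]
  simp

lemma fejD_cont (m : ℕ) : Continuous (FejD m) := by unfold FejD; fun_prop

lemma fejD_per (m : ℕ) : Function.Periodic (FejD m) (2 * π) := by
  intro x
  unfold FejD
  have e : ∀ k : ℕ, (k:ℝ) * (x + 2 * π) = k * x + k * (2 * π) := fun k => by ring
  simp only [e, Real.cos_add_nat_mul_two_pi, Real.sin_add_nat_mul_two_pi]

lemma fejD_int (m : ℕ) : ∫ t in (-π)..π, |FejD m t| ≤ 8 * π * (m * (m - 1)) := by
  rcases Nat.lt_or_ge m 2 with h | h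
  · have : m = 0 ∨ m = 1 := by omega
    rcases this with rfl | rfl <;> simp [FejD]
  have hm : (2:ℝ) ≤ m := by exact_mod_cast h
  have h1 : ∫ t in (-π)..π, |FejD m t| ≤ ∫ t in (-π)..π, (m * Fej m t +
      (1 / m) * ((∑ p ∈ Finset.range m, p * Real.cos (p * t)) ^ 2 +
      (∑ p ∈ Finset.range m, p * Real.sin (p * t)) ^ 2)) := by
    have hc := fejD_cont m
    have hc' := fej_cont m
    refine intervalIntegral.integral_mono_on (by linarith [Real.pi_pos])
      (Continuous.intervalIntegrable (by fun_prop) _ _)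
      (Continuous.intervalIntegrable (by fun_prop) _ _) fun t _ => ?_
    unfold FejD Fej
    set A := ∑ p ∈ Finset.range m, Real.cos (p * t)
    set B := ∑ p ∈ Finset.range m, Real.sin (p * t)
    set C := ∑ p ∈ Finset.range m, p * Real.cos (p * t)
    set D := ∑ p ∈ Finset.range m, p * Real.sin (p * t)
    have e : ∀ X Y : ℝ, 0 ≤ m * X ^ 2 + 1 / m * Y ^ 2 + 2 * X * Y := by
      intro X Y
      have : m * X ^ 2 + 1 / m * Y ^ 2 + 2 * X * Y = (1 / m) * (m * X + Y) ^ 2 := by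
        field_simp; ring
      rw [this]; positivity
    rw [abs_le]
    constructor
    · have := e A (-D); have := e B C; nlinarith
    · have := e A D; have := e B (-C); nlinarith
  refine h1.trans ?_
  have hc' := fej_cont m
  rw [intervalIntegral.integral_add (Continuous.intervalIntegrable (by fun_prop) _ _)
    (Continuous.intervalIntegrable (by fun_prop) _ _), intervalIntegral.integral_const_mul,
    intervalIntegral.integral_const_mul, fej_int, int_quad m (fun p => (p:ℝ))]
  have h2 : ∑ p ∈ Finset.range m, (p:ℝ) ^ 2 ≤ (m:ℝ) ^ 3 := by
    calc _ ≤ ∑ p ∈ Finset.range m, (m:ℝ) ^ 2 := by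
          refine Finset.sum_le_sum fun p hp => ?_
          have : (p:ℝ) ≤ m := by exact_mod_cast (Finset.mem_range.1 hp).le
          gcongr
      _ = _ := by simp; ring
  calc _ ≤ (m:ℝ) * (2 * π * m) + 1 / m * (2 * π * m ^ 3) := by gcongr
    _ = 4 * π * (m * m) := by field_simp; ring
    _ ≤ 4 * π * (m * (2 * (m - 1))) := by gcongr; linarith
    _ = _ := by ring

def Sh (n m : ℕ) (θ t : ℝ) : ℝ :=
  ∑ j ∈ Finset.range m, ((m:ℝ) - j) * Real.cos (((n:ℝ) + j) * t - θ)

lemma sh_cont (n m : ℕ) (θ : ℝ) : Continuous (Sh n m θ) := by unfold Sh; fun_prop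

lemma dbl (g : ℤ → ℝ) (m : ℕ) :
    ∑ p ∈ Finset.range m, ∑ q ∈ Finset.range m, g ((p:ℤ) - q) =
    ∑ j ∈ Finset.range m, ((m:ℝ) - j) * g j +
      ∑ j ∈ Finset.range (m - 1), ((m:ℝ) - 1 - j) * g (-(j:ℤ) - 1) := by
  induction m with
  | zero => simp
  | succ m ih =>
    have h1 : ∑ p ∈ Finset.range (m+1), ∑ q ∈ Finset.range (m+1), g ((p:ℤ) - q) =
        ∑ p ∈ Finset.range m, ∑ q ∈ Finset.range m, g ((p:ℤ) - q) +
        ∑ p ∈ Finset.range m, g ((p:ℤ) - m) + ∑ q ∈ Finset.range (m+1), g ((m:ℤ) - q) := by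
      rw [Finset.sum_range_succ]
      congr 1
      rw [← Finset.sum_add_distrib]
      exact Finset.sum_congr rfl fun p _ => Finset.sum_range_succ _ _
    have h2 : ∑ q ∈ Finset.range (m+1), g ((m:ℤ) - q) = ∑ j ∈ Finset.range (m+1), g j := by
      rw [← Finset.sum_range_reflect]
      refine Finset.sum_congr rfl fun j hj => ?_
      have := Finset.mem_range.1 hj
      congr 1; omega
    have h3 : ∑ p ∈ Finset.range m, g ((p:ℤ) - m) = ∑ j ∈ Finset.range m, g (-(j:ℤ) - 1) := by
      rw [← Finset.sum_range_reflect]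
      refine Finset.sum_congr rfl fun j hj => ?_
      have := Finset.mem_range.1 hj
      congr 1; omega
    have h4 : ∑ j ∈ Finset.range (m+1), (((m+1:ℕ):ℝ) - j) * g j =
        ∑ j ∈ Finset.range m, ((m:ℝ) - j) * g j + ∑ j ∈ Finset.range (m+1), g j := by
      rw [Finset.sum_range_succ, Finset.sum_range_succ _ m, ← add_assoc, ← Finset.sum_add_distrib]
      congr 1
      · exact Finset.sum_congr rfl fun j _ => by push_cast; ring
      · push_cast; ring
    have h5 : ∑ j ∈ Finset.range (m+1-1), (((m+1:ℕ):ℝ) - 1 - j) * g (-(j:ℤ) - 1) =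
        ∑ j ∈ Finset.range (m-1), ((m:ℝ) - 1 - j) * g (-(j:ℤ) - 1) +
        ∑ j ∈ Finset.range m, g (-(j:ℤ) - 1) := by
      rcases m with _ | m
      · simp
      · simp only [Nat.add_sub_cancel]
        rw [Finset.sum_range_succ, Finset.sum_range_succ _ m, ← add_assoc,
          ← Finset.sum_add_distrib]
        congr 1
        · exact Finset.sum_congr rfl fun j _ => by push_cast; ring
        · push_cast; ring
    rw [h1, h2, h3, h4, h5, ih]; ring

lemma cosfej {n : ℕ} (hn : 0 < n) (m : ℕ) (θ t : ℝ) : Real.cos (n * t - θ) * Fej m t =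
    Sh n m θ t + (∑ j ∈ Finset.range (min (m - 1) (2 * n - 1)),
      ((m:ℝ) - 1 - j) * Real.cos ((((n:ℤ) - 1 - j : ℤ) : ℝ) * t - θ)) +
      Sh n (m - 2 * n) (-θ) t := by
  have h1 : Real.cos (n * t - θ) * Fej m t = ∑ p ∈ Finset.range m, ∑ q ∈ Finset.range m,
      Real.cos (((n + ((p:ℤ) - q) : ℤ) : ℝ) * t - θ) := by
    have e1 : ∑ p ∈ Finset.range m, ∑ q ∈ Finset.range m,
        Real.cos (((n + ((p:ℤ) - q) : ℤ) : ℝ) * t - θ) =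
        ∑ p ∈ Finset.range m, ∑ q ∈ Finset.range m,
        Real.cos (((n + ((q:ℤ) - p) : ℤ) : ℝ) * t - θ) := Finset.sum_comm
    have e2 : Real.cos (n * t - θ) * Fej m t = (∑ p ∈ Finset.range m, ∑ q ∈ Finset.range m,
        Real.cos (((n + ((p:ℤ) - q) : ℤ) : ℝ) * t - θ) + ∑ p ∈ Finset.range m,
        ∑ q ∈ Finset.range m, Real.cos (((n + ((q:ℤ) - p) : ℤ) : ℝ) * t - θ)) / 2 := by
      rw [fej_eq, Finset.mul_sum, ← Finset.sum_add_distrib, Finset.sum_div]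
      refine Finset.sum_congr rfl fun p _ => ?_
      rw [Finset.mul_sum, ← Finset.sum_add_distrib, Finset.sum_div]
      refine Finset.sum_congr rfl fun q _ => ?_
      have a1 : ((n + ((p:ℤ) - q) : ℤ) : ℝ) * t - θ = (n * t - θ) + ((p:ℝ) - q) * t := by
        push_cast; ring
      have a2 : ((n + ((q:ℤ) - p) : ℤ) : ℝ) * t - θ = (n * t - θ) - ((p:ℝ) - q) * t := by
        push_cast; ring
      rw [a1, a2, Real.cos_add, Real.cos_sub (n * t - θ) (((p:ℝ) - q) * t)]; ring
    rw [e2, ← e1]; ring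
  rw [h1, dbl (fun k => Real.cos (((n + k : ℤ) : ℝ) * t - θ)), add_assoc]
  congr 1
  · unfold Sh
    exact Finset.sum_congr rfl fun j _ => by push_cast; rfl
  have h2 : ∑ j ∈ Finset.range (m - 1), ((m:ℝ) - 1 - j) *
      Real.cos (((n + (-(j:ℤ) - 1) : ℤ) : ℝ) * t - θ) = ∑ j ∈ Finset.range (m - 1),
      ((m:ℝ) - 1 - j) * Real.cos ((((n:ℤ) - 1 - j : ℤ) : ℝ) * t - θ) :=
    Finset.sum_congr rfl fun j _ => by
      rw [show (n + (-(j:ℤ) - 1) : ℤ) = (n:ℤ) - 1 - j by ring]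
  rw [h2]
  rcases le_or_gt m (2 * n) with h | h
  · rw [Nat.sub_eq_zero_of_le h, min_eq_left (by omega)]
    simp [Sh]
  · obtain ⟨k, rfl⟩ := Nat.exists_eq_add_of_lt h
    · rw [min_eq_right (by omega)]
      have e1 : 2 * n + k + 1 - 1 = (2 * n - 1) + (k + 1) := by omega
      have e2 : 2 * n + k + 1 - 2 * n = k + 1 := by omega
      rw [e1, e2, Finset.sum_range_add]
      congr 1
      unfold Sh
      refine Finset.sum_congr rfl fun j _ => ?_
      have e3 : ((2 * n - 1 + j : ℕ) : ℝ) = 2 * n - 1 + j := by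
        rw [Nat.cast_add, Nat.cast_sub (by omega)]; push_cast; ring
      rw [show ((n:ℤ) - 1 - ((2 * n - 1 + j : ℕ) : ℤ)) = -(n + j : ℤ) by omega, e3]
      rw [← Real.cos_neg]
      congr 1
      · push_cast; ring
      · congr 1; push_cast; ring

lemma PP_congr {n : ℕ} {φ g g' : ℝ → ℝ} {B : ℝ} (h : PP n φ g B) (e : ∀ t, g t = g' t) :
    PP n φ g' B := by
  have : g = g' := funext e
  rwa [← this]

lemma PP_step {ω φ : ℝ → ℝ} (h : HC ω φ) {n : ℕ} (hn : 0 < n) (m : ℕ) (θ : ℝ) {B B' : ℝ}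
    (h1 : PP n φ (fun t => Real.cos (n * t - θ) * Fej m t) B)
    (h2 : PP n φ (Sh n (m - 2 * n) (-θ)) B') : PP n φ (Sh n m θ) (B + B') := by
  obtain ⟨hω, hφ, hp, hm⟩ := h
  have h3 : PP n φ (fun t => ∑ j ∈ Finset.range (min (m - 1) (2 * n - 1)),
      ((m:ℝ) - 1 - j) * Real.cos ((((n:ℤ) - 1 - j : ℤ) : ℝ) * t - θ)) 0 := by
    have := PP_sum (n := n) (φ := φ) (Finset.range (min (m - 1) (2 * n - 1)))
      (fun j t => ((m:ℝ) - 1 - j) * Real.cos ((((n:ℤ) - 1 - j : ℤ) : ℝ) * t - θ))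
      (fun j => |(m:ℝ) - 1 - j| * 0) hφ (fun j => by fun_prop) (fun j hj => by
        refine PP_smul _ (PP_cos hφ hp ?_ θ)
        have := Finset.mem_range.1 hj
        rw [abs_lt]; omega)
    simpa using this
  have hFc := fej_cont m
  have hSc := sh_cont n (m - 2 * n) (-θ)
  have h4 := PP_add hφ (by fun_prop) (by fun_prop) (PP_smul (-1) h3) (PP_smul (-1) h2)
  have h5 := PP_add hφ (by fun_prop) (by fun_prop) h1 h4
  refine PP_mono (PP_congr h5 fun t => ?_) (by simp)
  have := cosfej hn m θ t
  rw [this]; ring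

lemma PP_crude0 {ω φ : ℝ → ℝ} (h : HC ω φ) {n : ℕ} (hn : 0 < n) (m : ℕ) (θ : ℝ) :
    PP n φ (fun t => Real.cos (n * t - θ) * Fej m t) (3872 * ω (1 / n) * (2 * π * m)) := by
  have hFc := fej_cont m
  have hw := h.1.2.2.2.2 (1 / (n:ℝ)) (by positivity)
  refine PP_mono (PP_L1 h hn (by fun_prop)) ?_
  gcongr
  rw [← fej_int]
  refine intervalIntegral.integral_mono_on (by linarith [Real.pi_pos])
      (Continuous.intervalIntegrable (by fun_prop) _ _)
      (Continuous.intervalIntegrable (by fun_prop) _ _) fun t _ => ?_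
  rw [abs_mul, abs_of_nonneg (fej_nonneg m t)]
  have := Real.abs_cos_le_one (n * t - θ)
  have := fej_nonneg m t
  nlinarith

lemma PP_crude {ω φ : ℝ → ℝ} (h : HC ω φ) {n : ℕ} (hn : 0 < n) (m : ℕ) : ∀ θ : ℝ,
    PP n φ (Sh n m θ) (3872 * ω (1 / n) * (2 * π) * (m + m * (m - 1) / (2 * n))) := by
  have hw := h.1.2.2.2.2 (1 / (n:ℝ)) (by positivity)
  have hn' : (0:ℝ) < n := by exact_mod_cast hn
  induction m using Nat.strong_induction_on with
  | _ m ih =>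
  intro θ
  rcases Nat.eq_zero_or_pos m with rfl | hm
  · refine PP_mono (PP_congr (PP_zero φ) fun t => ?_) (by simp)
    simp [Sh]
  have h2 := ih (m - 2 * n) (by omega) (-θ)
  refine PP_mono (PP_step h hn m θ (PP_crude0 h hn m θ) h2) ?_
  have hm' : (1:ℝ) ≤ m := by exact_mod_cast hm
  have key : (((m - 2 * n : ℕ):ℝ) + ((m - 2 * n : ℕ):ℝ) * (((m - 2 * n : ℕ):ℝ) - 1) / (2 * n)) ≤
      m * (m - 1) / (2 * n) := by
    rcases le_total m (2 * n) with h3 | h3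
    · rw [Nat.sub_eq_zero_of_le h3]
      simp only [Nat.cast_zero, zero_mul, zero_div, add_zero]
      have : (0:ℝ) ≤ m - 1 := by linarith
      positivity
    · rw [Nat.cast_sub h3]
      push_cast
      rw [le_div_iff₀ (by positivity)]
      field_simp
      nlinarith
  have : 0 ≤ 3872 * ω (1 / n) * (2 * π) := by positivity
  nlinarith [mul_le_mul_of_nonneg_left key this]

lemma PP_fine {ω φ : ℝ → ℝ} (h : HC ω φ) {n : ℕ} (hn : 0 < n) (m : ℕ) (θ : ℝ) :
    PP n φ (Sh n m θ) (2 / π * eN n ω * m + 3872 * ω (1 / n) * (8 * π ^ 2) / n * (m * (m - 1)) +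
      3872 * ω (1 / n) * (2 * π) * (((m - 2 * n : ℕ):ℝ) +
        ((m - 2 * n : ℕ):ℝ) * (((m - 2 * n : ℕ):ℝ) - 1) / (2 * n))) := by
  have hw := h.1.2.2.2.2 (1 / (n:ℝ)) (by positivity)
  have hn' : (0:ℝ) < n := by exact_mod_cast hn
  refine PP_step h hn m θ ?_ (PP_crude h hn _ _)
  have h1 := PP_main h hn θ (fej_deriv m) (fejD_cont m) (fej_per m) (fejD_per m) (fej_nonneg m)
  refine PP_mono h1 ?_
  rw [fej_int]
  have h2 := mul_le_mul_of_nonneg_left (fejD_int m)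
    (by positivity : 0 ≤ 3872 * ω (1 / n) * (π / n))
  refine (add_le_add le_rfl h2).trans (le_of_eq ?_)
  field_simp

lemma hat_gen (a : ℕ → ℝ) (j N : ℕ) (h : j ≤ N) :
    ∑ m ∈ Finset.range N, (a m - 2 * a (m + 1) + a (m + 2)) * ((m + 1 - j : ℕ) : ℝ) =
      a j - a N - ((N:ℝ) - j) * (a N - a (N + 1)) := by
  induction N, h using Nat.le_induction with
  | base =>
    rw [Finset.sum_eq_zero]
    · ring
    · intro m hm
      have := Finset.mem_range.1 hm
      rw [Nat.sub_eq_zero_of_le (by omega)]; simp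
  | succ N h ih =>
    rw [Finset.sum_range_succ, ih, Nat.cast_sub (by omega)]
    push_cast; ring

lemma hat_decomp (a : ℕ → ℝ) (N : ℕ) (ha : ∀ j, N ≤ j → a j = 0) (j : ℕ) :
    ∑ m ∈ Finset.range N, (a m - 2 * a (m + 1) + a (m + 2)) * ((m + 1 - j : ℕ) : ℝ) = a j := by
  rcases le_total j N with h | h
  · rw [hat_gen a j N h, ha N le_rfl, ha (N + 1) (by omega)]; ring
  · rw [ha j h]
    refine Finset.sum_eq_zero fun m hm => ?_
    have := Finset.mem_range.1 hm
    rw [Nat.sub_eq_zero_of_le (by omega)]; simp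

lemma tri (k : ℕ) : ∀ N, k ≤ N →
    (k:ℝ) * (k - 1) = 2 * ∑ j ∈ Finset.range N, ((k - (j + 1) : ℕ) : ℝ) := by
  induction k with
  | zero => intro N _; simp
  | succ k ih =>
    intro N hN
    obtain ⟨N, rfl⟩ : ∃ N', N = N' + 1 := ⟨N - 1, by omega⟩
    rw [Finset.sum_range_succ']
    have := ih N (by omega)
    have e : ∀ j ∈ Finset.range N, ((k + 1 - (j + 1 + 1) : ℕ) : ℝ) = ((k - (j + 1) : ℕ) : ℝ) :=
      fun j _ => by congr 1; omega
    rw [Finset.sum_congr rfl e]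
    push_cast
    simp
    linarith

lemma PP_seq {ω φ : ℝ → ℝ} (h : HC ω φ) {n : ℕ} (hn : 0 < n) (θ : ℝ) (a : ℕ → ℝ) (N : ℕ)
    (ha : ∀ j, N ≤ j → a j = 0) (hc : ∀ j, 0 ≤ a j - 2 * a (j + 1) + a (j + 2)) :
    PP n φ (fun t => ∑ j ∈ Finset.range N, a j * Real.cos (((n:ℝ) + j) * t - θ))
      (2 / π * eN n ω * a 0 +
        3872 * ω (1 / n) * (8 * π ^ 2) / n * (2 * ∑ j ∈ Finset.range N, a (j + 1)) +
        3872 * ω (1 / n) * (2 * π) * (a (2 * n) +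
          (2 * ∑ j ∈ Finset.range N, a (2 * n + (j + 1))) / (2 * n))) := by
  set c : ℕ → ℝ := fun m => a m - 2 * a (m + 1) + a (m + 2) with hcdef
  have hdec : ∀ j, ∑ m ∈ Finset.range N, c m * ((m + 1 - j : ℕ) : ℝ) = a j := hat_decomp a N ha
  have h1 := PP_sum (n := n) (φ := φ) (Finset.range N) (fun m t => c m * Sh n (m + 1) θ t) _ h.2.1
    (fun m => (sh_cont n (m + 1) θ).const_mul (c m))
    (fun m _ => PP_smul (c m) (PP_fine h hn (m + 1) θ))
  have h2 := PP_congr h1 (g' := fun t => ∑ j ∈ Finset.range N,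
      a j * Real.cos (((n:ℝ) + j) * t - θ)) (fun t => by
    have e : ∀ m ∈ Finset.range N, c m * Sh n (m + 1) θ t = ∑ j ∈ Finset.range N,
        c m * ((m + 1 - j : ℕ) : ℝ) * Real.cos (((n:ℝ) + j) * t - θ) := by
      intro m hm
      have hm := Finset.mem_range.1 hm
      unfold Sh
      rw [Finset.mul_sum]
      rw [← Finset.sum_subset (Finset.range_mono (show m + 1 ≤ N by omega))]
      · refine Finset.sum_congr rfl fun j hj => ?_
        have := Finset.mem_range.1 hj
        rw [Nat.cast_sub (by omega), mul_assoc]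
      · intro j _ hj
        simp only [Finset.mem_range, not_lt] at hj
        rw [Nat.sub_eq_zero_of_le hj]; simp
    rw [Finset.sum_congr rfl e, Finset.sum_comm]
    refine Finset.sum_congr rfl fun j _ => ?_
    rw [← Finset.sum_mul, hdec])
  refine PP_mono h2 (le_of_eq ?_)
  have s1 : ∑ m ∈ Finset.range N, c m * ((m + 1 : ℕ) : ℝ) = a 0 := hdec 0
  have s2 : ∑ m ∈ Finset.range N, c m * (((m + 1 : ℕ) : ℝ) * (((m + 1 : ℕ) : ℝ) - 1)) =
      2 * ∑ j ∈ Finset.range N, a (j + 1) := by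
    rw [Finset.mul_sum]
    simp only [← hdec, Finset.mul_sum]
    rw [Finset.sum_comm]
    refine Finset.sum_congr rfl fun m hm => ?_
    rw [tri (m + 1) N (by have := Finset.mem_range.1 hm; omega), Finset.mul_sum, Finset.mul_sum]
    exact Finset.sum_congr rfl fun j _ => by ring
  have s3 := hdec (2 * n)
  have s4 : ∑ m ∈ Finset.range N, c m * (((m + 1 - 2 * n : ℕ) : ℝ) *
      (((m + 1 - 2 * n : ℕ) : ℝ) - 1)) = 2 * ∑ j ∈ Finset.range N, a (2 * n + (j + 1)) := by
    rw [Finset.mul_sum]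
    simp only [← hdec, Finset.mul_sum]
    rw [Finset.sum_comm]
    refine Finset.sum_congr rfl fun m hm => ?_
    rw [tri (m + 1 - 2 * n) N (by have := Finset.mem_range.1 hm; omega), Finset.mul_sum,
      Finset.mul_sum]
    exact Finset.sum_congr rfl fun j _ => by rw [Nat.sub_sub]; ring
  rw [← s1, ← s2, ← s3, ← s4, Finset.sum_div, ← Finset.sum_add_distrib, Finset.mul_sum,
    Finset.mul_sum, Finset.mul_sum, ← Finset.sum_add_distrib, ← Finset.sum_add_distrib]
  refine Finset.sum_congr rfl fun m _ => ?_
  rw [abs_of_nonneg (hc m)]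
  ring

/-! properties of ψ -/

lemma psi_anti {ψ η : ℝ → ℝ} (h : IsMInfPlus ψ η) : AntitoneOn ψ (Set.Ici 1) := by
  obtain ⟨hpos, hc, hconv, hlim, hη, hmono, htop⟩ := h
  intro x hx y hy hxy
  by_contra hlt
  push Not at hlt
  have hxy' : x < y := lt_of_le_of_ne hxy fun e => by rw [e] at hlt; exact lt_irrefl _ hlt
  have h1 : ∀ z, y < z → ψ y ≤ ψ z := by
    intro z hz
    have hz1 : z ∈ Set.Ici (1:ℝ) := le_trans hy hz.le
    have h2 := hconv.slope_mono_adjacent hx hz1 hxy' hz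
    have h3 : 0 < (ψ y - ψ x) / (y - x) := div_pos (by linarith) (by linarith)
    have h4 : 0 < (ψ z - ψ y) / (z - y) := lt_of_lt_of_le h3 h2
    have h5 : 0 < z - y := by linarith
    have := (div_pos_iff_of_pos_right h5).1 h4
    linarith
  have h2 : ψ y ≤ 0 := ge_of_tendsto hlim ((eventually_gt_atTop y).mono h1)
  exact absurd (hpos y hy) (not_lt.2 h2)

lemma psi_half {ψ η : ℝ → ℝ} (h : IsMInfPlus ψ η) {n : ℕ} (hn : 0 < n) {μ : ℝ}
    (hμ : μ = (n:ℝ) / (η n - n)) (hμ2 : 2 < μ) {s : ℝ} (hs : (n:ℝ) ≤ s) :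
    ψ ((1 + 1 / μ) * s) ≤ ψ s / 2 := by
  have hanti := psi_anti h
  obtain ⟨hpos, hc, hconv, hlim, hη, hmono, htop⟩ := h
  have hn1 : (1:ℝ) ≤ n := by exact_mod_cast hn
  have hs1 : 1 ≤ s := hn1.trans hs
  obtain ⟨h1, h2⟩ := hη s hs1
  have h3 : μ ≤ s / (η s - s) := by rw [hμ]; exact hmono hn1 hs1 hs
  have h4 : 0 < η s - s := by linarith
  rw [le_div_iff₀ h4] at h3
  have h5 : η s ≤ (1 + 1 / μ) * s := by
    have : η s - s ≤ s / μ := by rw [le_div_iff₀ (by linarith)]; linarith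
    have e : (1 + 1 / μ) * s = s + s / μ := by ring
    linarith
  rw [← h2]
  exact hanti (le_trans hs1 h1.le) (le_trans (le_trans hs1 h1.le) h5) h5

lemma psi_int {ψ η : ℝ → ℝ} (h : IsMInfPlus ψ η) {n : ℕ} (hn : 0 < n) {μ : ℝ}
    (hμ : μ = (n:ℝ) / (η n - n)) (hμ2 : 2 < μ) {t X : ℝ} (ht : (n:ℝ) ≤ t) (hX : t ≤ X) :
    ∫ s in t..X, ψ s ≤ 2 / (μ - 1) * (t * ψ t) := by
  have hanti := psi_anti h
  have hhalf := fun s (hs : (n:ℝ) ≤ s) => psi_half h hn hμ hμ2 hs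
  obtain ⟨hpos, hc, hconv, hlim, hη, hmono, htop⟩ := h
  have hn1 : (1:ℝ) ≤ n := by exact_mod_cast hn
  have ht1 : 1 ≤ t := hn1.trans ht
  set q := 1 + 1 / μ with hq
  have hμ0 : 0 < μ := by linarith
  have hq1 : 1 < q := by rw [hq]; have : 0 < 1 / μ := by positivity
                         linarith
  have hint : ∀ a b, 1 ≤ a → a ≤ b → IntervalIntegrable ψ volume a b := by
    intro a b ha hab
    apply ContinuousOn.intervalIntegrable
    rw [Set.uIcc_of_le hab]
    exact hc.mono fun x hx => ha.trans hx.1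
  have hnn : ∀ a b, 1 ≤ a → a ≤ b → 0 ≤ ∫ s in a..b, ψ s := fun a b ha hab =>
    intervalIntegral.integral_nonneg hab fun x hx => (hpos x (ha.trans hx.1)).le
  -- extend to q * X
  have htq : t ≤ q * t := by nlinarith
  have hXq : X ≤ q * X := by nlinarith
  have hqtX : q * t ≤ q * X := by nlinarith
  have a1 : ∫ s in t..(q * X), ψ s = (∫ s in t..(q * t), ψ s) + ∫ s in (q * t)..(q * X), ψ s :=
    (intervalIntegral.integral_add_adjacent_intervals (hint _ _ ht1 htq)
      (hint _ _ (ht1.trans htq) hqtX)).symm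
  have a2 : ∫ s in t..(q * X), ψ s = (∫ s in t..X, ψ s) + ∫ s in X..(q * X), ψ s :=
    (intervalIntegral.integral_add_adjacent_intervals (hint _ _ ht1 hX)
      (hint _ _ (ht1.trans hX) hXq)).symm
  have a3 := hnn X (q * X) (ht1.trans hX) hXq
  have a4 : ∫ s in t..(q * t), ψ s ≤ (q - 1) * t * ψ t := by
    have : ∫ s in t..(q * t), ψ s ≤ ∫ s in t..(q * t), ψ t :=
      intervalIntegral.integral_mono_on htq (hint _ _ ht1 htq) (by simp) fun x hx =>
        hanti ht1 (ht1.trans hx.1) hx.1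
    rw [intervalIntegral.integral_const, smul_eq_mul] at this
    linarith
  have a5 : ∫ s in (q * t)..(q * X), ψ s = q * ∫ s in t..X, ψ (q * s) := by
    rw [intervalIntegral.integral_comp_mul_left (fun s => ψ s) (by linarith : q ≠ 0), smul_eq_mul]
    field_simp
  have a6 : ∫ s in t..X, ψ (q * s) ≤ ∫ s in t..X, ψ s / 2 := by
    refine intervalIntegral.integral_mono_on hX ?_ ?_ fun s hs => hhalf s (ht.trans hs.1)
    · apply ContinuousOn.intervalIntegrable
      rw [Set.uIcc_of_le hX]
      refine hc.comp (by fun_prop) fun x hx => ?_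
      have : 1 ≤ x := ht1.trans hx.1
      simp only [Set.mem_Ici]; nlinarith
    · exact (hint _ _ ht1 hX).div_const 2
  rw [intervalIntegral.integral_div] at a6
  set I := ∫ s in t..X, ψ s
  have a7 : I ≤ (q - 1) * t * ψ t + q * (I / 2) := by
    have := mul_le_mul_of_nonneg_left a6 (by linarith : 0 ≤ q)
    linarith
  have hqμ : (q - 1) * μ = 1 := by rw [hq]; field_simp; ring
  rw [div_mul_eq_mul_div, le_div_iff₀ (by linarith)]
  have a8 := mul_le_mul_of_nonneg_left a7 (by linarith : 0 ≤ 2 * μ)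
  have e1 : q * μ = μ + 1 := by linarith
  have : 2 * μ * ((q - 1) * t * ψ t + q * (I / 2)) = 2 * ((q - 1) * μ) * (t * ψ t) +
    (q * μ) * I := by ring
  rw [this, hqμ, e1] at a8
  linarith

lemma psi_sum {ψ η : ℝ → ℝ} (h : IsMInfPlus ψ η) {n : ℕ} (hn : 0 < n) {μ : ℝ}
    (hμ : μ = (n:ℝ) / (η n - n)) (hμ2 : 2 < μ) {t : ℝ} (ht : (n:ℝ) ≤ t) (N : ℕ) :
    ∑ j ∈ Finset.range N, ψ (t + (j + 1 : ℕ)) ≤ 2 / (μ - 1) * (t * ψ t) := by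
  have hn1 : (1:ℝ) ≤ n := by exact_mod_cast hn
  have h1 : AntitoneOn ψ (Set.Icc t (t + N)) := (psi_anti h).mono fun x hx =>
    (hn1.trans ht).trans hx.1
  exact (h1.sum_le_integral).trans (psi_int h hn hμ hμ2 ht (by simp))

lemma psi_summable {ψ η : ℝ → ℝ} (h : IsMInfPlus ψ η) {n : ℕ} (hn : 0 < n) {μ : ℝ}
    (hμ : μ = (n:ℝ) / (η n - n)) (hμ2 : 2 < μ) : Summable (fun k : ℕ => ψ (k + 1)) := by
  rw [← summable_nat_add_iff n]
  refine summable_of_sum_range_le (c := 2 / (μ - 1) * (n * ψ n)) (fun k => ?_) fun N => ?_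
  · exact (h.1 _ (by push_cast; linarith [(Nat.cast_nonneg k : (0:ℝ) ≤ k),
      (Nat.cast_nonneg n : (0:ℝ) ≤ n)])).le
  · refine le_trans (le_of_eq ?_) (psi_sum h hn hμ hμ2 le_rfl N)
    refine Finset.sum_congr rfl fun j _ => ?_
    congr 1; push_cast; ring

lemma eps_tsum {p : ℕ → ℝ} (hp : Summable p) (h0 : ∀ j, 0 ≤ p j) {δ : ℝ} (hδ : 0 < δ) :
    ∃ ε > 0, ∑' j, min (p j) ε ≤ δ := by
  have h : Tendsto (fun ε : ℝ => ∑' j, min (p j) ε) (nhdsWithin 0 (Set.Ioi 0))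
      (nhds (∑' _ : ℕ, (0:ℝ))) := by
    refine tendsto_tsum_of_dominated_convergence hp (fun j => ?_) ?_
    · have : Tendsto (fun ε : ℝ => min (p j) ε) (nhds 0) (nhds (min (p j) 0)) :=
        (continuous_const.min continuous_id).tendsto 0
      rw [min_eq_right (h0 j)] at this
      exact this.mono_left nhdsWithin_le_nhds
    · filter_upwards [self_mem_nhdsWithin] with ε hε j
      rw [Real.norm_eq_abs, abs_of_nonneg (le_min (h0 j) (le_of_lt hε))]
      exact min_le_left _ _
  rw [tsum_zero] at h
  have h1 := h.eventually (gt_mem_nhds hδ)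
  obtain ⟨ε, h2, h3⟩ := (h1.and self_mem_nhdsWithin).exists
  exact ⟨ε, h3, h2.le⟩

lemma ker_summable {ψ : ℝ → ℝ} (hs : Summable (fun k : ℕ => ψ (k + 1)))
    (hpos : ∀ t ≥ (1:ℝ), 0 < ψ t) (β t : ℝ) :
    Summable (fun k : ℕ => ψ (k + 1) * Real.cos ((k + 1) * t - β * π / 2)) := by
  refine Summable.of_norm_bounded hs fun k => ?_
  have h0 : 0 < ψ (k + 1) := hpos _ (by simp)
  rw [Real.norm_eq_abs, abs_mul, abs_of_pos h0]
  exact mul_le_of_le_one_right h0.le (Real.abs_cos_le_one _)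

lemma ker_cont {ψ : ℝ → ℝ} (hs : Summable (fun k : ℕ => ψ (k + 1)))
    (hpos : ∀ t ≥ (1:ℝ), 0 < ψ t) (β : ℝ) : Continuous (PsiKer ψ β) := by
  unfold PsiKer
  refine continuous_tsum (fun k => by fun_prop) hs fun k t => ?_
  have h0 : 0 < ψ (k + 1) := hpos _ (by simp)
  rw [Real.norm_eq_abs, abs_mul, abs_of_pos h0]
  exact mul_le_of_le_one_right h0.le (Real.abs_cos_le_one _)

lemma ker_per (ψ : ℝ → ℝ) (β : ℝ) : Function.Periodic (PsiKer ψ β) (2 * π) := by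
  intro t
  unfold PsiKer
  refine tsum_congr fun k => ?_
  have e : ((k:ℝ) + 1) * (t + 2 * π) - β * π / 2 =
    ((k + 1) * t - β * π / 2) + ((k + 1 : ℕ) : ℝ) * (2 * π) := by push_cast; ring
  rw [e, Real.cos_add_nat_mul_two_pi]

lemma per_bdd {φ : ℝ → ℝ} (hφ : Continuous φ) (hp : Function.Periodic φ (2 * π)) :
    ∃ M, ∀ x, |φ x| ≤ M := by
  obtain ⟨M, hM⟩ := (isCompact_Icc (a := (0:ℝ)) (b := 2 * π)).exists_bound_of_continuousOn
    hφ.continuousOn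
  refine ⟨M, fun x => ?_⟩
  obtain ⟨y, hy, e⟩ := hp.exists_mem_Ico₀ (by positivity) x
  rw [e]
  exact hM y ⟨hy.1, hy.2.le⟩

lemma eN_nonneg {ω : ℝ → ℝ} (hω : IsModulus ω) (n : ℕ) : 0 ≤ eN n ω := by
  unfold eN
  refine intervalIntegral.integral_nonneg (by positivity) fun t ht => ?_
  refine mul_nonneg (hω.2.2.2.2 _ (div_nonneg (by linarith [ht.1]) (Nat.cast_nonneg n)))
    (Real.sin_nonneg_of_nonneg_of_le_pi ht.1 (by linarith [ht.2, Real.pi_pos]))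

/-- main upper bound -/
lemma PP_ker {ψ η : ℝ → ℝ} (h : IsMInfPlus ψ η) {n : ℕ} (hn : 0 < n) {μ : ℝ}
    (hμ : μ = (n:ℝ) / (η n - n)) (hμ2 : 2 < μ) {ω φ : ℝ → ℝ} (hH : HC ω φ) (β : ℝ) {B : ℝ}
    (hB : ∀ (a : ℕ → ℝ) (N : ℕ), (∀ j, 0 ≤ a j) → (∀ j : ℕ, a j ≤ ψ ((n:ℝ) + j)) →
      (2 / π * eN n ω * a 0 +
        3872 * ω (1 / n) * (8 * π ^ 2) / n * (2 * ∑ j ∈ Finset.range N, a (j + 1)) +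
        3872 * ω (1 / n) * (2 * π) * (a (2 * n) +
          (2 * ∑ j ∈ Finset.range N, a (2 * n + (j + 1))) / (2 * n))) ≤ B)
    {δ : ℝ} (hδ : 0 < δ) : PP n φ (PsiKer ψ β) (B + δ) := by
  have hs := psi_summable h hn hμ hμ2
  have hanti := psi_anti h
  obtain ⟨hpos, hc, hconv, hlim, hη, hmono, htop⟩ := h
  obtain ⟨m, rfl⟩ : ∃ m, n = m + 1 := ⟨n - 1, by omega⟩
  set p : ℕ → ℝ := fun j => ψ (((m + 1 : ℕ):ℝ) + j) with hp
  have hp0 : ∀ j, 0 ≤ p j := fun j => (hpos _ (by push_cast; have : (0:ℝ) ≤ m := by positivity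
                                                  have : (0:ℝ) ≤ j := by positivity
                                                  linarith)).le
  have hps : Summable p := by
    have := (summable_nat_add_iff m).2 hs
    refine this.congr fun j => ?_
    simp only [hp]; congr 1; push_cast; ring
  obtain ⟨M, hM⟩ := per_bdd hH.2.1 hH.2.2.1
  have hM0 : 0 ≤ M := (abs_nonneg _).trans (hM 0)
  obtain ⟨ε, hε, hε2⟩ := eps_tsum hps hp0 (δ := δ / (2 * (M + 1))) (by positivity)
  set a : ℕ → ℝ := fun j => max (p j - ε) 0 with ha
  have hap : ∀ j, a j ≤ p j := fun j => max_le (by linarith) (hp0 j)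
  have ha0 : ∀ j, 0 ≤ a j := fun j => le_max_right _ _
  have hmin : ∀ j, p j - a j = min (p j) ε := by
    intro j
    simp only [ha]
    rcases le_total (p j) ε with h | h
    · rw [min_eq_left h, max_eq_right (by linarith)]; ring
    · rw [min_eq_right h, max_eq_left (by linarith)]; ring
  have hfin : ∃ N, ∀ j, N ≤ j → a j = 0 := by
    have h1 := hps.tendsto_atTop_zero.eventually (gt_mem_nhds hε)
    obtain ⟨N, hN⟩ := eventually_atTop.1 h1
    exact ⟨N, fun j hj => max_eq_right (by linarith [hN j hj])⟩
  obtain ⟨N, hN⟩ := hfin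
  have hpc : ∀ j, 0 ≤ p j - 2 * p (j + 1) + p (j + 2) := by
    intro j
    have hm0 : (0:ℝ) ≤ m := by positivity
    have hj0 : (0:ℝ) ≤ j := by positivity
    have u1 : ((m + 1 : ℕ):ℝ) + j ∈ Set.Ici (1:ℝ) := by
      simp only [Set.mem_Ici]; push_cast; linarith
    have u2 : ((m + 1 : ℕ):ℝ) + (j + 2 : ℕ) ∈ Set.Ici (1:ℝ) := by
      simp only [Set.mem_Ici]; push_cast; linarith
    have h1 := hconv.2 u1 u2 (show (0:ℝ) ≤ 1 / 2 by norm_num) (show (0:ℝ) ≤ 1 / 2 by norm_num)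
      (by norm_num)
    simp only [smul_eq_mul] at h1
    have e : 1 / 2 * (((m + 1 : ℕ):ℝ) + j) + 1 / 2 * (((m + 1 : ℕ):ℝ) + (j + 2 : ℕ)) =
      ((m + 1 : ℕ):ℝ) + (j + 1 : ℕ) := by push_cast; ring
    rw [e] at h1
    simp only [hp]
    linarith
  have hac : ∀ j, 0 ≤ a j - 2 * a (j + 1) + a (j + 2) := by
    intro j
    have h1 := hpc j
    have h2 : p j - ε ≤ a j := le_max_left _ _
    have h3 : p (j + 2) - ε ≤ a (j + 2) := le_max_left _ _
    have h4 := ha0 j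
    have h5 := ha0 (j + 2)
    rcases max_choice (p (j + 1) - ε) 0 with h6 | h6 <;>
    · have : a (j + 1) = _ := h6
      rw [this]; linarith
  have hkc := ker_cont hs hpos β
  -- three pieces
  have g1 := PP_sum (n := m + 1) (φ := φ) (Finset.range m)
    (fun k t => ψ (k + 1) * Real.cos ((k + 1) * t - β * π / 2)) (fun _ => 0) hH.2.1
    (fun k => by fun_prop) (fun k hk => by
      have hk := Finset.mem_range.1 hk
      have := PP_smul (ψ (k + 1)) (PP_cos (n := m + 1) hH.2.1 hH.2.2.1 (k := ((k + 1 : ℕ) : ℤ))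
        (by rw [abs_of_nonneg (by positivity)]; exact_mod_cast Nat.succ_lt_succ hk) (β * π / 2))
      rw [mul_zero] at this
      refine PP_congr this fun t => ?_
      push_cast; ring)
  have g2 := PP_mono (PP_seq hH hn (β * π / 2) a N hN hac) (hB a N ha0 hap)
  have key : ∀ t, |PsiKer ψ β t - (∑ k ∈ Finset.range m,
      ψ (k + 1) * Real.cos ((k + 1) * t - β * π / 2)) - ∑ j ∈ Finset.range N,
        a j * Real.cos ((((m + 1 : ℕ):ℝ) + j) * t - β * π / 2)| ≤ δ / (2 * (M + 1)) := by
    intro t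
    have hsum := ker_summable hs hpos β t
    have e1 : PsiKer ψ β t - (∑ k ∈ Finset.range m,
      ψ (k + 1) * Real.cos ((k + 1) * t - β * π / 2)) =
        ∑' j : ℕ, p j * Real.cos ((((m + 1 : ℕ):ℝ) + j) * t - β * π / 2) := by
      unfold PsiKer
      rw [← hsum.sum_add_tsum_nat_add m, add_sub_cancel_left]
      refine tsum_congr fun j => ?_
      simp only [hp]
      have : ((j + m : ℕ) : ℝ) + 1 = ((m + 1 : ℕ):ℝ) + j := by push_cast; ring
      rw [this]
    have hs1 : Summable (fun j : ℕ => p j * Real.cos ((((m + 1 : ℕ):ℝ) + j) * t - β * π / 2)) := by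
      refine Summable.of_norm_bounded hps fun k => ?_
      rw [Real.norm_eq_abs, abs_mul, abs_of_nonneg (hp0 k)]
      exact mul_le_of_le_one_right (hp0 k) (Real.abs_cos_le_one _)
    have hs2 : Summable (fun j : ℕ => a j * Real.cos ((((m + 1 : ℕ):ℝ) + j) * t - β * π / 2)) := by
      refine Summable.of_norm_bounded hps fun k => ?_
      rw [Real.norm_eq_abs, abs_mul, abs_of_nonneg (ha0 k)]
      exact (mul_le_of_le_one_right (ha0 k) (Real.abs_cos_le_one _)).trans (hap k)
    have e2 : ∑ j ∈ Finset.range N, a j * Real.cos ((((m + 1 : ℕ):ℝ) + j) * t - β * π / 2) =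
        ∑' j : ℕ, a j * Real.cos ((((m + 1 : ℕ):ℝ) + j) * t - β * π / 2) := by
      rw [tsum_eq_sum]
      intro j hj
      simp only [Finset.mem_range, not_lt] at hj
      rw [hN j hj, zero_mul]
    rw [e1, e2, ← hs1.tsum_sub hs2]
    have hs3 : Summable (fun j => min (p j) ε) :=
      Summable.of_nonneg_of_le (fun j => le_min (hp0 j) hε.le) (fun j => min_le_left _ _) hps
    have := tsum_of_norm_bounded (f := fun j : ℕ => p j * Real.cos ((((m + 1 : ℕ):ℝ) + j) * t - β * π / 2)
      - a j * Real.cos ((((m + 1 : ℕ):ℝ) + j) * t - β * π / 2)) hs3.hasSum (fun j => by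
        rw [← sub_mul, hmin, Real.norm_eq_abs, abs_mul, abs_of_nonneg (le_min (hp0 j) hε.le)]
        exact mul_le_of_le_one_right (le_min (hp0 j) hε.le) (Real.abs_cos_le_one _))
    rw [Real.norm_eq_abs] at this
    exact this.trans hε2
  have g3 := PP_sup (n := m + 1) hM key
  have c1 : Continuous fun t : ℝ => ∑ k ∈ Finset.range m,
      ψ (k + 1) * Real.cos ((k + 1) * t - β * π / 2) := by fun_prop
  have c2 : Continuous fun t : ℝ => ∑ j ∈ Finset.range N,
        a j * Real.cos ((((m + 1 : ℕ):ℝ) + j) * t - β * π / 2) := by fun_prop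
  have g := PP_add hH.2.1 (c1.add c2) ((hkc.sub c1).sub c2) (PP_add hH.2.1 c1 c2 g1 g2) g3
  refine PP_mono (PP_congr g fun t => by simp only [Pi.add_apply, Pi.sub_apply]; ring) ?_
  have : 2 * M * (δ / (2 * (M + 1))) ≤ δ := by
    rw [mul_div_assoc', div_le_iff₀ (by positivity)]
    nlinarith
  simp only [Finset.sum_const_zero]
  linarith

lemma EnC_le_of {n : ℕ} {f T : ℝ → ℝ} (hT : IsTrigPoly n T) {B : ℝ}
    (h : ∀ x, |f x - T x| ≤ B) : EnC n f ≤ B := by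
  unfold EnC
  have hb : BddBelow {e | ∃ T : ℝ → ℝ, IsTrigPoly n T ∧ e = ⨆ x : ℝ, |f x - T x|} := by
    refine ⟨0, ?_⟩
    rintro e ⟨T, _, rfl⟩
    exact Real.iSup_nonneg fun x => abs_nonneg _
  exact (csInf_le hb ⟨T, hT, rfl⟩).trans (ciSup_le h)

lemma numeric {E W a0 S1 a2 S2 Y Q P3 n μ : ℝ} (hn : 1 ≤ n) (hμ : 2 < μ) (hE : 0 ≤ E) (hW : 0 ≤ W)
    (hQ : 0 ≤ Q) (hP3 : 0 ≤ P3)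
    (h0 : a0 ≤ Y) (h1 : S1 ≤ Q + 2 / (μ - 1) * ((n + 1) * Q)) (h2 : a2 ≤ P3)
    (h3 : S2 ≤ 2 / (μ - 1) * (3 * n * P3)) :
    2 / π * E * a0 + 3872 * W * (8 * π ^ 2) / n * (2 * S1) +
      3872 * W * (2 * π) * (a2 + (2 * S2) / (2 * n)) ≤
    2 / π * Y * E + 10000000 * (Q * (1 / n + 1 / (μ - 2)) + P3) * W := by
  have hn0 : 0 < n := by linarith
  have hpi := Real.pi_pos
  have hpi4 : π ≤ 4 := Real.pi_le_four
  have t1 : 2 / π * E * a0 ≤ 2 / π * Y * E := by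
    have : 2 / π * E * a0 ≤ 2 / π * E * Y := mul_le_mul_of_nonneg_left h0 (by positivity)
    linarith
  have hd : 0 < 1 / (μ - 2) := by have : 0 < μ - 2 := by linarith
                                  positivity
  have hd2 : 2 / (μ - 1) ≤ 2 * (1 / (μ - 2)) := by
    rw [mul_one_div]
    exact div_le_div_of_nonneg_left (by norm_num) (by linarith) (by linarith)
  have hd3 : 2 / (μ - 1) ≤ 2 := by
    rw [div_le_iff₀ (by linarith)]; linarith
  have q1 : S1 / n ≤ 4 * (Q * (1 / n + 1 / (μ - 2))) := by
    rw [div_le_iff₀ hn0]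
    have e : 4 * (Q * (1 / n + 1 / (μ - 2))) * n = 4 * Q + 4 * (n * Q) * (1 / (μ - 2)) := by
      field_simp
    rw [e]
    have : 2 / (μ - 1) * ((n + 1) * Q) ≤ 2 * (1 / (μ - 2)) * (2 * n * Q) := by
      apply mul_le_mul hd2 _ (by positivity) (by positivity)
      apply mul_le_mul_of_nonneg_right _ hQ
      linarith
    nlinarith
  have q2 : (2 * S2) / (2 * n) ≤ 6 * P3 := by
    rw [div_le_iff₀ (by positivity)]
    have : 2 / (μ - 1) * (3 * n * P3) ≤ 2 * (3 * n * P3) :=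
      mul_le_mul_of_nonneg_right hd3 (by positivity)
    linarith
  have hpi2 : π ^ 2 ≤ 16 := by nlinarith
  have t2 : 3872 * W * (8 * π ^ 2) / n * (2 * S1) ≤
      10000000 * (Q * (1 / n + 1 / (μ - 2))) * W := by
    have hX : 0 ≤ Q * (1 / n + 1 / (μ - 2)) := by positivity
    calc _ = 3872 * 16 * W * π ^ 2 * (S1 / n) := by ring
      _ ≤ 3872 * 16 * W * π ^ 2 * (4 * (Q * (1 / n + 1 / (μ - 2)))) :=
        mul_le_mul_of_nonneg_left q1 (by positivity)
      _ = 247808 * (W * (Q * (1 / n + 1 / (μ - 2)))) * π ^ 2 := by ring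
      _ ≤ 247808 * (W * (Q * (1 / n + 1 / (μ - 2)))) * 16 :=
        mul_le_mul_of_nonneg_left hpi2 (by positivity)
      _ ≤ _ := by have : 0 ≤ W * (Q * (1 / n + 1 / (μ - 2))) := mul_nonneg hW hX
                  linarith
  have t3 : 3872 * W * (2 * π) * (a2 + (2 * S2) / (2 * n)) ≤ 10000000 * P3 * W := by
    calc _ ≤ 3872 * W * (2 * π) * (7 * P3) :=
        mul_le_mul_of_nonneg_left (by linarith) (by positivity)
      _ = 54208 * (W * P3) * π := by ring
      _ ≤ 54208 * (W * P3) * 4 := mul_le_mul_of_nonneg_left hpi4 (by positivity)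
      _ ≤ _ := by have : 0 ≤ W * P3 := mul_nonneg hW hP3
                  linarith
  linarith

lemma upper {ψ η : ℝ → ℝ} (h : IsMInfPlus ψ η) {n : ℕ} (hn : 0 < n)
    (hμ2 : 2 < (n:ℝ) / (η n - n)) {ω f : ℝ → ℝ} (hω : IsModulus ω) (β : ℝ)
    (hf : f ∈ CClass ψ β ω) :
    EnC n f ≤ (2 / π) * ψ n * eN n ω + 10000000 * (ψ (n + 1) *
      (1 / n + 1 / ((n : ℝ) / (η n - n) - 2)) + ψ (3 * n)) * ω (1 / n) := by
  obtain ⟨_, _, a₀, φ, hφ, hφp, _, hmod, hfx⟩ := hf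
  have hH : HC ω φ := ⟨hω, hφ, hφp, hmod⟩
  refine le_of_forall_pos_le_add fun δ hδ => ?_
  have hn1 : (1:ℝ) ≤ n := by exact_mod_cast hn
  have hpos := h.1
  obtain ⟨T, hT, hTx⟩ := PP_ker h hn rfl hμ2 hH β (B := (2 / π) * ψ n * eN n ω + 10000000 *
    (ψ (n + 1) * (1 / n + 1 / ((n : ℝ) / (η n - n) - 2)) + ψ (3 * n)) * ω (1 / n)) (by
    intro a N ha0 ha
    refine numeric hn1 hμ2 (eN_nonneg hω n) (hω.2.2.2.2 _ (by positivity))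
      (hpos _ (by linarith)).le (hpos _ (by linarith)).le ?_ ?_ ?_ ?_
    · simpa using ha 0
    · have h1 : ∑ j ∈ Finset.range N, a (j + 1) ≤ ∑ j ∈ Finset.range (N + 1), a (j + 1) :=
        Finset.sum_le_sum_of_subset_of_nonneg (Finset.range_mono (by omega)) fun j _ _ => ha0 _
      rw [Finset.sum_range_succ'] at h1
      have h2 := psi_sum h hn rfl hμ2 (t := (n:ℝ) + 1) (by linarith) N
      have h3 : ∑ j ∈ Finset.range N, a (j + 1 + 1) ≤
          ∑ j ∈ Finset.range N, ψ ((n:ℝ) + 1 + (j + 1 : ℕ)) := by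
        refine Finset.sum_le_sum fun j _ => ?_
        have := ha (j + 1 + 1)
        have e : (n:ℝ) + 1 + (j + 1 : ℕ) = n + (j + 1 + 1 : ℕ) := by push_cast; ring
        rw [e]; exact this
      have h4 : a (0 + 1) ≤ ψ (n + 1) := by simpa using ha 1
      linarith
    · have := ha (2 * n)
      have e : (n:ℝ) + (2 * n : ℕ) = 3 * n := by push_cast; ring
      rwa [e] at this
    · have h2 := psi_sum h hn rfl hμ2 (t := 3 * (n:ℝ)) (by linarith) N
      refine le_trans (Finset.sum_le_sum fun j _ => ?_) h2
      have := ha (2 * n + (j + 1))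
      have e : (n:ℝ) + (2 * n + (j + 1) : ℕ) = 3 * n + (j + 1 : ℕ) := by push_cast; ring
      rwa [e] at this) hδ
  refine EnC_le_of (tp_add (tp_const hn (a₀ / 2)) hT) fun x => ?_
  rw [hfx x]
  have := hTx x
  rwa [add_sub_add_left_eq_sub]

lemma as_le (x y : ℝ) :
    Real.arcsin (Real.sin x) ≤ Real.arcsin (Real.sin y) + |x - y| := by
  set b := Real.arcsin (Real.sin y) with hb
  have hsb : Real.sin b = Real.sin y := Real.sin_arcsin (Real.neg_one_le_sin y) (Real.sin_le_one y)
  have hcb : |Real.cos y| ≤ Real.cos b := by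
    have h0 : 0 ≤ Real.cos b := Real.cos_arcsin_nonneg _
    refine abs_le_of_sq_le_sq (le_of_eq ?_) h0
    have h1 := Real.sin_sq_add_cos_sq y
    have h2 := Real.sin_sq_add_cos_sq b
    rw [hsb] at h2
    linarith
  have hb1 : -(π / 2) ≤ b := Real.neg_pi_div_two_le_arcsin _
  rcases le_or_gt (π / 2) (b + |x - y|) with h | h
  · exact (Real.arcsin_le_pi_div_two _).trans h
  · have hd0 := abs_nonneg (x - y)
    have hs : 0 ≤ Real.sin |x - y| := Real.sin_nonneg_of_nonneg_of_le_pi hd0 (by linarith)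
    have hsd : |Real.sin (x - y)| = Real.sin |x - y| := by
      rcases abs_choice (x - y) with e | e
      · rw [e] at hs ⊢; exact abs_of_nonneg hs
      · rw [e] at hs ⊢
        rw [Real.sin_neg] at hs ⊢
        exact abs_of_nonpos (by linarith)
    have h1 : Real.sin x ≤ Real.sin (b + |x - y|) := by
      have e : x = y + (x - y) := by ring
      rw [Real.sin_add, hsb, Real.cos_abs]
      conv_lhs => rw [e, Real.sin_add]
      have : Real.cos y * Real.sin (x - y) ≤ Real.cos b * Real.sin |x - y| := by
        calc _ ≤ |Real.cos y * Real.sin (x - y)| := le_abs_self _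
          _ = |Real.cos y| * Real.sin |x - y| := by rw [abs_mul, hsd]
          _ ≤ _ := mul_le_mul_of_nonneg_right hcb hs
      linarith
    calc _ ≤ Real.arcsin (Real.sin (b + |x - y|)) := Real.monotone_arcsin h1
      _ = _ := Real.arcsin_sin (by linarith) h.le

lemma as_lip (x y : ℝ) :
    |Real.arcsin (Real.sin x) - Real.arcsin (Real.sin y)| ≤ |x - y| := by
  rw [abs_le]
  have h1 := as_le x y
  have h2 := as_le y x
  rw [abs_sub_comm] at h2
  constructor <;> linarith

def gO (ω : ℝ → ℝ) (u : ℝ) : ℝ := if 0 ≤ u then ω (2 * u) / 2 else -(ω (2 * (-u)) / 2)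

lemma gO_neg {ω : ℝ → ℝ} (h0 : ω 0 = 0) (u : ℝ) : gO ω (-u) = -gO ω u := by
  unfold gO
  rcases lt_trichotomy u 0 with h | h | h
  · rw [if_pos (by linarith), if_neg (by linarith)]; ring
  · subst h; simp [h0]
  · rw [if_neg (by linarith), if_pos (by linarith)]; simp

lemma gO_le {ω : ℝ → ℝ} (hω : IsModulus ω) (hc : ConcaveOn ℝ (Set.Ici 0) ω) {u v : ℝ}
    (h : u ≤ v) : gO ω u ≤ gO ω v ∧ gO ω v - gO ω u ≤ ω (v - u) := by
  obtain ⟨_, hm, hs, h0, hp⟩ := hω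
  have A : ∀ u v : ℝ, 0 ≤ u → u ≤ v → ω (2 * u) / 2 ≤ ω (2 * v) / 2 ∧
      ω (2 * v) / 2 - ω (2 * u) / 2 ≤ ω (v - u) := by
    intro u v hu huv
    have a1 : ω (2 * u) ≤ ω (2 * v) := hm (by simp; linarith) (by simp; linarith) (by linarith)
    have a2 := hs (2 * u) (2 * (v - u)) (by linarith) (by linarith)
    have a3 := hs (v - u) (v - u) (by linarith) (by linarith)
    have e : 2 * u + 2 * (v - u) = 2 * v := by ring
    have e2 : v - u + (v - u) = 2 * (v - u) := by ring
    rw [e] at a2; rw [e2] at a3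
    constructor <;> linarith
  unfold gO
  rcases le_or_gt 0 u with hu | hu
  · rw [if_pos hu, if_pos (hu.trans h)]; exact A u v hu h
  · rw [if_neg (by linarith)]
    rcases le_or_gt 0 v with hv | hv
    · rw [if_pos hv]
      have a1 := hp (2 * v) (by linarith)
      have a2 := hp (2 * -u) (by linarith)
      have u1 : 2 * v ∈ Set.Ici (0:ℝ) := by simp only [Set.mem_Ici]; linarith
      have u2 : 2 * -u ∈ Set.Ici (0:ℝ) := by simp only [Set.mem_Ici]; linarith
      have a3 := hc.2 u1 u2 (show (0:ℝ) ≤ 1 / 2 by norm_num) (show (0:ℝ) ≤ 1 / 2 by norm_num)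
        (by norm_num)
      simp only [smul_eq_mul] at a3
      have e : 1 / 2 * (2 * v) + 1 / 2 * (2 * -u) = v - u := by ring
      rw [e] at a3
      constructor <;> linarith
    · rw [if_neg (by linarith)]
      have := A (-v) (-u) (by linarith) (by linarith)
      have e : -u - -v = v - u := by ring
      rw [e] at this
      constructor <;> linarith [this.1, this.2]

lemma gO_mod {ω : ℝ → ℝ} (hω : IsModulus ω) (hc : ConcaveOn ℝ (Set.Ici 0) ω) (u v : ℝ) :
    |gO ω u - gO ω v| ≤ ω |u - v| := by
  rcases le_total u v with h | h
  · have := gO_le hω hc h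
    rw [abs_sub_comm, abs_of_nonneg (by linarith [this.1]), abs_sub_comm,
      abs_of_nonneg (by linarith : 0 ≤ v - u)]
    exact this.2
  · have := gO_le hω hc h
    rw [abs_of_nonneg (by linarith [this.1]), abs_of_nonneg (by linarith : 0 ≤ u - v)]
    exact this.2

lemma gO_abs {ω : ℝ → ℝ} (hω : IsModulus ω) {u d : ℝ} (h : |u| ≤ d) :
    |gO ω u| ≤ ω (2 * d) / 2 := by
  obtain ⟨_, hm, hs, h0, hp⟩ := hω
  have a := abs_le.1 h
  have hd : 0 ≤ d := (abs_nonneg u).trans h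
  unfold gO
  split_ifs with hu
  · rw [abs_of_nonneg (div_nonneg (hp _ (by linarith)) (by norm_num))]
    have := hm (a := 2 * u) (b := 2 * d) (by simp; linarith) (by simp; linarith) (by linarith)
    linarith
  · rw [abs_neg, abs_of_nonneg (div_nonneg (hp _ (by linarith)) (by norm_num))]
    have := hm (a := 2 * -u) (b := 2 * d) (by simp only [Set.mem_Ici]; linarith)
      (by simp; linarith) (by linarith)
    linarith

def phS (ω : ℝ → ℝ) (n : ℕ) (t : ℝ) : ℝ := gO ω (Real.arcsin (Real.sin (n * t)) / n)

lemma phS_anti {ω : ℝ → ℝ} (h0 : ω 0 = 0) {n : ℕ} (hn : 0 < n) :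
    Function.Antiperiodic (phS ω n) (π / n) := by
  intro t
  have hn' : (0:ℝ) < n := by exact_mod_cast hn
  unfold phS
  have e : (n:ℝ) * (t + π / n) = n * t + π := by field_simp
  rw [e, Real.sin_add_pi, Real.arcsin_neg, neg_div, gO_neg h0]

lemma phS_per {ω : ℝ → ℝ} {n : ℕ} : Function.Periodic (phS ω n) (2 * π) := by
  intro t
  unfold phS
  rw [mul_add, Real.sin_add_nat_mul_two_pi]

lemma phS_odd {ω : ℝ → ℝ} (h0 : ω 0 = 0) (n : ℕ) (t : ℝ) : phS ω n (-t) = -phS ω n t := by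
  unfold phS
  rw [mul_neg, Real.sin_neg, Real.arcsin_neg, neg_div, gO_neg h0]

lemma phS_mod {ω : ℝ → ℝ} (hω : IsModulus ω) (hc : ConcaveOn ℝ (Set.Ici 0) ω) {n : ℕ}
    (hn : 0 < n) : ∀ t : ℝ, 0 ≤ t → ∀ x h : ℝ, |h| ≤ t → |phS ω n (x + h) - phS ω n x| ≤ ω t := by
  intro t ht x h hh
  have hn' : (0:ℝ) < n := by exact_mod_cast hn
  unfold phS
  refine (gO_mod hω hc _ _).trans (hω.2.1 (Set.mem_Ici.2 (abs_nonneg _)) ht ?_)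
  rw [← sub_div, abs_div, abs_of_pos hn', div_le_iff₀ hn']
  refine (as_lip _ _).trans ?_
  have e : (n:ℝ) * (x + h) - n * x = h * n := by ring
  rw [e, abs_mul, abs_of_pos hn']
  exact mul_le_mul_of_nonneg_right hh hn'.le

lemma phS_cont {ω : ℝ → ℝ} (hω : IsModulus ω) (hc : ConcaveOn ℝ (Set.Ici 0) ω) {n : ℕ}
    (hn : 0 < n) : Continuous (phS ω n) := by
  rw [Metric.continuous_iff]
  intro b ε hε
  have h1 := hω.1 0 (by simp)
  rw [Metric.continuousWithinAt_iff] at h1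
  obtain ⟨δ, hδ, h2⟩ := h1 ε hε
  refine ⟨δ, hδ, fun a ha => ?_⟩
  rw [Real.dist_eq] at ha ⊢
  have h3 := phS_mod hω hc hn |a - b| (abs_nonneg _) b (a - b) le_rfl
  rw [add_sub_cancel] at h3
  have h4 := h2 (x := |a - b|) (by simp) (by simpa using ha)
  rw [hω.2.2.2.1, Real.dist_eq, sub_zero] at h4
  exact h3.trans_lt ((le_abs_self _).trans_lt h4)

lemma phS_abs {ω : ℝ → ℝ} (hω : IsModulus ω) {n : ℕ} (hn : 0 < n) (t : ℝ) :
    |phS ω n t| ≤ 5 / 2 * ω (1 / n) := by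
  have hn' : (0:ℝ) < n := by exact_mod_cast hn
  unfold phS
  have h1 := gO_abs hω (u := Real.arcsin (Real.sin (n * t)) / n) (d := π / 2 / n) (by
    rw [abs_div, abs_of_pos hn']
    refine div_le_div_of_nonneg_right (abs_le.2 ⟨Real.neg_pi_div_two_le_arcsin _,
      Real.arcsin_le_pi_div_two _⟩) hn'.le)
  have h2 := mod_bound hω n hn (s := 2 * (π / 2 / n)) (by positivity)
  have e : (n:ℝ) * (2 * (π / 2 / n)) = π := by field_simp
  rw [e] at h2
  have h3 := hω.2.2.2.2 (1 / n) (by positivity)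
  have h4 : (1 + π) * ω (1 / n) ≤ 5 * ω (1 / n) :=
    mul_le_mul_of_nonneg_right (by linarith [Real.pi_le_four]) h3
  linarith

lemma phS_mean {ω : ℝ → ℝ} (hω : IsModulus ω) (hc : ConcaveOn ℝ (Set.Ici 0) ω) {n : ℕ}
    (hn : 0 < n) : ∫ t in (-π)..π, phS ω n t = 0 := by
  rw [sym_int (phS_cont hω hc hn)]
  simp [phS_odd hω.2.2.2.1]

lemma phS_main {ω : ℝ → ℝ} (hω : IsModulus ω) (hc : ConcaveOn ℝ (Set.Ici 0) ω) {n : ℕ}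
    (hn : 0 < n) : ∫ t in (-π)..π, phS ω n t * Real.sin (n * t) = 2 * eN n ω := by
  have hn' : (0:ℝ) < n := by exact_mod_cast hn
  have hcont : Continuous fun t => phS ω n t * Real.sin (n * t) := by
    have := phS_cont hω hc hn
    fun_prop
  have hper : Function.Periodic (fun t => phS ω n t * Real.sin (n * t)) (π / n) := by
    intro t
    have e : (n:ℝ) * (t + π / n) = n * t + π := by field_simp
    simp only [phS_anti hω.2.2.2.1 hn t, e, Real.sin_add_pi]
    ring
  have hper2 : Function.Periodic (fun t => phS ω n t * Real.sin (n * t)) (2 * π) := by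
    intro t
    simp only [phS_per t, mul_add, Real.sin_add_nat_mul_two_pi]
  rw [split_int hcont hper2 hn (-(π / 2))]
  have hl : ∀ l ∈ Finset.range (2 * n),
      ∫ t in ((-(π / 2) + l * π) / n)..((-(π / 2) + (l + 1 : ℕ) * π) / n),
        phS ω n t * Real.sin (n * t) = eN n ω / n := by
    intro l _
    have h1 := hper.intervalIntegral_add_eq ((-(π / 2) + l * π) / n) (-(π / (2 * n)))
    have e1 : (-(π / 2) + l * π) / n + π / n = (-(π / 2) + (l + 1 : ℕ) * π) / n := by
      push_cast; ring
    have e2 : -(π / (2 * n)) + π / n = π / (2 * n) := by field_simp; ring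
    rw [e1, e2] at h1
    rw [h1, sym_int hcont, ← eN_sub ω n hn]
    have hd : 0 ≤ π / (2 * n) := by positivity
    refine intervalIntegral.integral_congr fun u hu => ?_
    rw [Set.uIcc_of_le hd] at hu
    simp only [phS_odd hω.2.2.2.1, mul_neg, Real.sin_neg]
    have e3 : (n:ℝ) * (π / (2 * n)) = π / 2 := by field_simp
    have h2 : (n:ℝ) * u ≤ π / 2 := by rw [← e3]; exact mul_le_mul_of_nonneg_left hu.2 hn'.le
    have h3 : 0 ≤ (n:ℝ) * u := mul_nonneg hn'.le hu.1
    have h4 : phS ω n u = ω (2 * (n * u) / n) / 2 := by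
      unfold phS gO
      rw [Real.arcsin_sin (by linarith [Real.pi_pos]) h2, if_pos (by positivity)]
      congr 2; ring
    rw [h4]; ring
  rw [Finset.sum_congr rfl hl, Finset.sum_const, Finset.card_range, nsmul_eq_mul]
  push_cast
  field_simp

lemma alt_tel (c : ℕ → ℝ) (N : ℕ) :
    ∑ l ∈ Finset.range N, (-1:ℝ) ^ l * (c (l + 1) + c l) = c 0 - (-1) ^ N * c N := by
  induction N with
  | zero => simp
  | succ N ih => rw [Finset.sum_range_succ, ih, pow_succ]; ring

lemma alt_sum {n : ℕ} (hn : 0 < n) (j : ℕ) (h : Real.cos (j * π / (2 * n)) ≠ 0) (A : ℝ) :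
    ∑ l ∈ Finset.range (2 * n), (-1:ℝ) ^ l * Real.cos (A + l * (j * π / n)) = 0 := by
  have hn' : (0:ℝ) < n := by exact_mod_cast hn
  have h1 := alt_tel (fun l => Real.cos (A - j * π / (2 * n) + l * (j * π / n))) (2 * n)
  have e1 : A - j * π / (2 * n) + ((2 * n : ℕ) : ℝ) * (j * π / n) =
      A - j * π / (2 * n) + j * (2 * π) := by push_cast; field_simp
  simp only [e1] at h1
  rw [Real.cos_add_nat_mul_two_pi, pow_mul] at h1
  have h2 : ∀ l : ℕ, Real.cos (A - j * π / (2 * n) + (l + 1 : ℕ) * (j * π / n)) +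
      Real.cos (A - j * π / (2 * n) + l * (j * π / n)) =
      2 * Real.cos (A + l * (j * π / n)) * Real.cos (j * π / (2 * n)) := by
    intro l
    have a1 : A - j * π / (2 * n) + (l + 1 : ℕ) * (j * π / n) =
      (A + l * (j * π / n)) + j * π / (2 * n) := by push_cast; field_simp; ring
    have a2 : A - j * π / (2 * n) + l * (j * π / n) =
      (A + l * (j * π / n)) - j * π / (2 * n) := by ring
    rw [a1, a2, Real.cos_add, Real.cos_sub]; ring
  simp only [h2] at h1
  have h3 : (∑ l ∈ Finset.range (2 * n), (-1:ℝ) ^ l * Real.cos (A + l * (j * π / n))) *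
      (2 * Real.cos (j * π / (2 * n))) = 0 := by
    rw [Finset.sum_mul]
    refine Eq.trans (Finset.sum_congr rfl fun l _ => ?_) (h1.trans ?_)
    · ring
    · simp
  rcases mul_eq_zero.1 h3 with h4 | h4
  · exact h4
  · exact absurd (by linarith) h

lemma alt_tp {n : ℕ} (hn : 0 < n) {T : ℝ → ℝ} (hT : IsTrigPoly n T) (x : ℝ) :
    ∑ l ∈ Finset.range (2 * n), (-1:ℝ) ^ l * T (x + l * (π / n)) = 0 := by
  have hn' : (0:ℝ) < n := by exact_mod_cast hn
  obtain ⟨a, b, h⟩ := hT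
  simp only [h, Finset.mul_sum]
  rw [Finset.sum_comm]
  refine Finset.sum_eq_zero fun j hj => ?_
  have hj : (j:ℝ) < n := by exact_mod_cast Finset.mem_range.1 hj
  have hc : Real.cos (j * π / (2 * n)) ≠ 0 := by
    refine (Real.cos_pos_of_mem_Ioo ⟨?_, ?_⟩).ne'
    · have : 0 ≤ j * π / (2 * n) := by positivity
      linarith [Real.pi_pos]
    · rw [div_lt_div_iff₀ (by positivity) (by positivity)]
      nlinarith [Real.pi_pos]
  have h1 := alt_sum hn j hc (j * x)
  have h2 := alt_sum hn j hc (j * x - π / 2)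
  have e : ∀ l ∈ Finset.range (2 * n), (-1:ℝ) ^ l * (a j * Real.cos (j * (x + l * (π / n))) +
      b j * Real.sin (j * (x + l * (π / n)))) =
      a j * ((-1:ℝ) ^ l * Real.cos (j * x + l * (j * π / n))) +
      b j * ((-1:ℝ) ^ l * Real.cos (j * x - π / 2 + l * (j * π / n))) := by
    intro l _
    have e1 : (j:ℝ) * (x + l * (π / n)) = j * x + l * (j * π / n) := by ring
    have e2 : j * x - π / 2 + l * (j * π / n) = j * x + l * (j * π / n) - π / 2 := by ring
    rw [e2, Real.cos_sub_pi_div_two, e1]; ring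
  rw [Finset.sum_congr rfl e, Finset.sum_add_distrib, ← Finset.mul_sum, ← Finset.mul_sum, h1, h2]
  simp

lemma EnC_ge {n : ℕ} (hn : 0 < n) {f : ℝ → ℝ} (hf : Continuous f)
    (hper : Function.Periodic f (2 * π)) (ha : Function.Antiperiodic f (π / n)) (x : ℝ) :
    |f x| ≤ EnC n f := by
  have hn' : (0:ℝ) < n := by exact_mod_cast hn
  unfold EnC
  refine le_csInf ⟨_, _, tp_zero n, rfl⟩ ?_
  rintro e ⟨T, hT, rfl⟩
  set S := ⨆ x : ℝ, |f x - T x| with hS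
  have hle : ∀ y, |f y - T y| ≤ S := by
    obtain ⟨M, hM⟩ := per_bdd (hf.sub (tp_cont hT)) (hper.sub (tp_per hT))
    intro y
    refine le_ciSup (f := fun x : ℝ => |f x - T x|) ⟨M, ?_⟩ y
    rintro _ ⟨z, rfl⟩
    exact hM z
  have h1 : ∑ l ∈ Finset.range (2 * n), (-1:ℝ) ^ l * (f (x + l * (π / n)) - T (x + l * (π / n))) =
      2 * n * f x := by
    simp only [mul_sub, Finset.sum_sub_distrib]
    rw [alt_tp hn hT, sub_zero]
    have : ∀ l ∈ Finset.range (2 * n), (-1:ℝ) ^ l * f (x + l * (π / n)) = f x := by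
      intro l _
      rw [ha.add_nat_mul_eq, ← mul_assoc, ← mul_pow]; simp
    rw [Finset.sum_congr rfl this]
    simp
  have h2 : |2 * n * f x| ≤ 2 * n * S := by
    rw [← h1]
    refine (Finset.abs_sum_le_sum_abs _ _).trans ?_
    have : ∀ l ∈ Finset.range (2 * n),
        |(-1:ℝ) ^ l * (f (x + l * (π / n)) - T (x + l * (π / n)))| ≤ S := by
      intro l _
      rw [abs_mul, abs_pow]
      simpa using hle _
    refine (Finset.sum_le_sum this).trans (le_of_eq ?_)
    simp
  rw [abs_mul, abs_of_pos (by positivity : (0:ℝ) < 2 * n)] at h2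
  exact le_of_mul_le_mul_left h2 (by positivity)

/-- vanishing of the non-resonant terms -/
lemma anti_term {n : ℕ} (hn : 0 < n) {φ : ℝ → ℝ} (hφ : Continuous φ)
    (hper : Function.Periodic φ (2 * π)) (ha : Function.Antiperiodic φ (π / n)) (x θ : ℝ) (k : ℕ)
    (hk : Real.cos (k * π / (2 * n)) ≠ 0) :
    ∫ t in (-π)..π, φ (x - t) * Real.cos (k * t - θ) = 0 := by
  have hn' : (0:ℝ) < n := by exact_mod_cast hn
  have hshift : ∀ l : ℕ, ∫ t in (-π)..π, φ (x - t) * Real.cos (k * t - θ) =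
      ∫ t in (-π)..π, φ (x - t) * ((-1) ^ l * Real.cos (k * t - θ + l * (k * π / n))) := by
    intro l
    have hp : Function.Periodic (fun t => φ (x - t) * Real.cos (k * t - θ)) (2 * π) := by
      intro t
      have e1 : x - (t + 2 * π) = (x - t) - 2 * π := by ring
      have e2 : (k:ℝ) * (t + 2 * π) - θ = (k * t - θ) + k * (2 * π) := by ring
      simp only [e1, e2, hper.sub_eq, Real.cos_add_nat_mul_two_pi]
    have h1 := hp.intervalIntegral_add_eq (-π) (-π + l * (π / n))
    have e1 : -π + 2 * π = π := by ring
    have e2 : -π + l * (π / n) + 2 * π = π + l * (π / n) := by ring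
    rw [e1, e2] at h1
    rw [h1, ← intervalIntegral.integral_comp_add_right
      (fun t => φ (x - t) * Real.cos (k * t - θ))]
    refine intervalIntegral.integral_congr fun t _ => ?_
    have e3 : (k:ℝ) * (t + l * (π / n)) - θ = k * t - θ + l * (k * π / n) := by ring
    have h2 := ha.add_nat_mul_eq (x := x - (t + l * (π / n))) l
    have e4 : x - (t + l * (π / n)) + l * (π / n) = x - t := by ring
    rw [e4] at h2
    simp only [e3, h2]
    have e5 : ((-1:ℝ) ^ l) * (-1) ^ l = 1 := by rw [← mul_pow]; simp
    linear_combination (-(φ (x - (t + l * (π / n))) *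
      Real.cos (k * t - θ + l * (k * π / n)))) * e5
  have h3 : ∑ l ∈ Finset.range (2 * n), ∫ t in (-π)..π, φ (x - t) * Real.cos (k * t - θ) = 0 := by
    rw [Finset.sum_congr rfl fun l _ => hshift l, ← intervalIntegral.integral_finsetSum]
    · simp only [← Finset.mul_sum, alt_sum hn k hk]
      simp
    · intro l _
      exact Continuous.intervalIntegrable (by fun_prop) _ _
  rw [Finset.sum_const, Finset.card_range, nsmul_eq_mul] at h3
  rcases mul_eq_zero.1 h3 with h | h
  · have : 2 * n = 0 := by exact_mod_cast h
    omega
  · exact h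

lemma ker_hasSum {ψ : ℝ → ℝ} (hs : Summable (fun k : ℕ => ψ (k + 1)))
    (hpos : ∀ t ≥ (1:ℝ), 0 < ψ t) (β : ℝ) {φ : ℝ → ℝ} (hφ : Continuous φ) {M : ℝ}
    (hM : ∀ x, |φ x| ≤ M) (x : ℝ) :
    HasSum (fun k : ℕ => ψ (k + 1) * ∫ t in (-π)..π,
      φ (x - t) * Real.cos ((k + 1 : ℕ) * t - β * π / 2))
      (∫ t in (-π)..π, φ (x - t) * PsiKer ψ β t) := by
  have h := intervalIntegral.hasSum_integral_of_dominated_convergence (a := -π) (b := π)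
    (μ := volume) (f := fun t => φ (x - t) * PsiKer ψ β t)
    (F := fun (k : ℕ) t => φ (x - t) * (ψ (k + 1) * Real.cos ((k + 1) * t - β * π / 2)))
    (fun k _ => M * ψ (k + 1)) (fun k => (by fun_prop : Continuous fun t : ℝ =>
      φ (x - t) * (ψ (k + 1) * Real.cos ((k + 1) * t - β * π / 2))).aestronglyMeasurable)
    (fun k => Eventually.of_forall fun t _ => by
      have h0 : 0 < ψ (k + 1) := hpos _ (by simp)
      rw [Real.norm_eq_abs, abs_mul, abs_mul, abs_of_pos h0]
      exact mul_le_mul (hM _) (mul_le_of_le_one_right h0.le (Real.abs_cos_le_one _))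
        (by positivity) ((abs_nonneg _).trans (hM 0)))
    (Eventually.of_forall fun t _ => hs.mul_left M)
    (by simp)
    (Eventually.of_forall fun t _ => (ker_summable hs hpos β t).hasSum.mul_left _)
  suffices e : (fun k : ℕ => ψ (k + 1) * ∫ t in (-π)..π,
      φ (x - t) * Real.cos ((k + 1 : ℕ) * t - β * π / 2)) = fun k : ℕ =>
      ∫ t in (-π)..π, φ (x - t) * (ψ (k + 1) * Real.cos ((k + 1) * t - β * π / 2)) by
    rw [e]; exact h
  funext k
  rw [← intervalIntegral.integral_const_mul]
  refine intervalIntegral.integral_congr fun t _ => ?_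
  push_cast; ring

lemma psi_odd {ψ η : ℝ → ℝ} (h : IsMInfPlus ψ η) {n : ℕ} (hn : 0 < n)
    (hμ2 : 2 < (n:ℝ) / (η n - n)) (N : ℕ) :
    ∑ i ∈ Finset.range N, ψ (2 * n * i + 3 * n) ≤ 4 * ψ (3 * n) := by
  have hn1 : (1:ℝ) ≤ n := by exact_mod_cast hn
  have hanti := psi_anti h
  have hpos := h.1
  have hN : ∀ i : ℕ, 0 ≤ ψ (2 * n * i + 3 * n) := fun i => (hpos _ (by
    have : (0:ℝ) ≤ 2 * n * i := by positivity
    linarith)).le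
  have h1 : ∑ i ∈ Finset.range N, ψ (2 * n * i + 3 * n) ≤
      ∑ i ∈ Finset.range (N + 1), ψ (2 * n * i + 3 * n) :=
    Finset.sum_le_sum_of_subset_of_nonneg (Finset.range_mono (by omega)) fun j _ _ => hN j
  rw [Finset.sum_range_succ'] at h1
  have h2 : AntitoneOn (fun s : ℝ => ψ (2 * n * s + 3 * n)) (Set.Icc 0 (0 + (N:ℝ))) := by
    intro s hs t ht hst
    have hs0 := hs.1
    have ht0 := ht.1
    have a1 : 0 ≤ 2 * n * s := by positivity
    have a2 : 2 * n * s ≤ 2 * n * t := mul_le_mul_of_nonneg_left hst (by positivity)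
    exact hanti (by simp only [Set.mem_Ici]; linarith) (by simp only [Set.mem_Ici]; linarith)
      (by linarith)
  have h3 := h2.sum_le_integral
  simp only [zero_add] at h3
  rw [intervalIntegral.integral_comp_mul_add ψ (by positivity) (3 * (n:ℝ)), smul_eq_mul, mul_zero,
    zero_add] at h3
  have h4 := psi_int h hn rfl hμ2 (t := 3 * (n:ℝ)) (X := 2 * n * N + 3 * n) (by linarith)
    (by have : (0:ℝ) ≤ 2 * n * N := by positivity
        linarith)
  have hp3 : 0 ≤ ψ (3 * n) := (hpos _ (by linarith)).le
  have hd3 : 2 / ((n:ℝ) / (η n - n) - 1) ≤ 2 := by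
    rw [div_le_iff₀ (by linarith)]; linarith
  have h5 : (2 * (n:ℝ))⁻¹ * ∫ s in 3 * (n:ℝ)..2 * n * N + 3 * n, ψ s ≤ 3 * ψ (3 * n) := by
    rw [inv_mul_le_iff₀ (by positivity)]
    refine h4.trans ((mul_le_mul_of_nonneg_right hd3 (by positivity)).trans (le_of_eq ?_))
    ring
  have e0 : ψ (2 * n * ((0:ℕ):ℝ) + 3 * n) = ψ (3 * n) := by simp
  rw [e0] at h1
  linarith

def fS (ψ : ℝ → ℝ) (β : ℝ) (ω : ℝ → ℝ) (n : ℕ) (x : ℝ) : ℝ :=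
  (1 / π) * ∫ t in (-π)..π, phS ω n (x - t) * PsiKer ψ β t

lemma fS_cont {ψ : ℝ → ℝ} (hs : Summable (fun k : ℕ => ψ (k + 1)))
    (hpos : ∀ t ≥ (1:ℝ), 0 < ψ t) (β : ℝ) {ω : ℝ → ℝ} (hω : IsModulus ω)
    (hc : ConcaveOn ℝ (Set.Ici 0) ω) {n : ℕ} (hn : 0 < n) : Continuous (fS ψ β ω n) := by
  have h1 := phS_cont hω hc hn
  have h2 := ker_cont hs hpos β
  unfold fS
  refine continuous_const.mul ?_
  apply intervalIntegral.continuous_parametric_intervalIntegral_of_continuous'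
  unfold Function.uncurry
  fun_prop

lemma fS_anti (ψ : ℝ → ℝ) (β : ℝ) {ω : ℝ → ℝ} (hω : IsModulus ω) {n : ℕ} (hn : 0 < n) :
    Function.Antiperiodic (fS ψ β ω n) (π / n) := by
  intro x
  unfold fS
  rw [← mul_neg, ← intervalIntegral.integral_neg]
  congr 1
  refine intervalIntegral.integral_congr fun t _ => ?_
  have e : x + π / n - t = x - t + π / n := by ring
  simp only [e, phS_anti hω.2.2.2.1 hn (x - t)]
  ring

lemma fS_per (ψ : ℝ → ℝ) (β : ℝ) (ω : ℝ → ℝ) (n : ℕ) :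
    Function.Periodic (fS ψ β ω n) (2 * π) := by
  intro x
  unfold fS
  congr 1
  refine intervalIntegral.integral_congr fun t _ => ?_
  have e : x + 2 * π - t = x - t + 2 * π := by ring
  simp only [e, phS_per (x - t)]

lemma fS_mem {ψ : ℝ → ℝ} (hs : Summable (fun k : ℕ => ψ (k + 1)))
    (hpos : ∀ t ≥ (1:ℝ), 0 < ψ t) (β : ℝ) {ω : ℝ → ℝ} (hω : IsModulus ω)
    (hc : ConcaveOn ℝ (Set.Ici 0) ω) {n : ℕ} (hn : 0 < n) : fS ψ β ω n ∈ CClass ψ β ω :=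
  ⟨fS_cont hs hpos β hω hc hn, fS_per ψ β ω n, 0, phS ω n, phS_cont hω hc hn, phS_per,
    phS_mean hω hc hn, phS_mod hω hc hn, fun x => by simp [fS]⟩

lemma phS_term {ω : ℝ → ℝ} (hω : IsModulus ω) (hc : ConcaveOn ℝ (Set.Ici 0) ω) {n : ℕ}
    (hn : 0 < n) (θ : ℝ) :
    ∫ t in (-π)..π, phS ω n ((θ + π / 2) / n - t) * Real.cos (n * t - θ) = 2 * eN n ω := by
  have hn' : (0:ℝ) < n := by exact_mod_cast hn
  rw [← phS_main hω hc hn]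
  have h1 := conv_flip (phS_per (ω := ω) (n := n)) (g := fun t => Real.cos (n * t - θ)) (by
    intro t
    have e2 : (n:ℝ) * (t + 2 * π) - θ = (n * t - θ) + n * (2 * π) := by ring
    simp only [e2, Real.cos_add_nat_mul_two_pi]) ((θ + π / 2) / n)
  rw [h1]
  refine intervalIntegral.integral_congr fun t _ => ?_
  have e : (n:ℝ) * ((θ + π / 2) / n - t) - θ = π / 2 - n * t := by field_simp; ring
  simp only [e, Real.cos_pi_div_two_sub]
  ring

lemma lower {ψ η : ℝ → ℝ} (h : IsMInfPlus ψ η) {n : ℕ} (hn : 0 < n)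
    (hμ2 : 2 < (n:ℝ) / (η n - n)) {ω : ℝ → ℝ} (hω : IsModulus ω)
    (hc : ConcaveOn ℝ (Set.Ici 0) ω) (β : ℝ) :
    (2 / π) * ψ n * eN n ω - 20 * ψ (3 * n) * ω (1 / n) ≤ EnC n (fS ψ β ω n) := by
  have hs := psi_summable h hn rfl hμ2
  have hpos := h.1
  have hn' : (0:ℝ) < n := by exact_mod_cast hn
  have hn1 : (1:ℝ) ≤ n := by exact_mod_cast hn
  set θ := β * π / 2 with hθ
  set x := (θ + π / 2) / n with hx
  set W := ω (1 / n) with hW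
  have hW0 : 0 ≤ W := hω.2.2.2.2 _ (by positivity)
  refine le_trans ?_ (EnC_ge hn (fS_cont hs hpos β hω hc hn) (fS_per ψ β ω n)
    (fS_anti ψ β hω hn) x)
  refine le_trans ?_ (le_abs_self _)
  have hphc := phS_cont hω hc hn
  set I : ℕ → ℝ := fun k => ∫ t in (-π)..π, phS ω n (x - t) * Real.cos (k * t - θ) with hI
  have hsum := ker_hasSum hs hpos β hphc (phS_abs hω hn) x
  have hIb : ∀ k, |I k| ≤ 5 * π * W := by
    intro k
    have h1 := intervalIntegral.norm_integral_le_of_norm_le_const (a := -π) (b := π)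
      (f := fun t => phS ω n (x - t) * Real.cos (k * t - θ)) (C := 5 / 2 * W) (fun t _ => by
        rw [Real.norm_eq_abs, abs_mul]
        exact (mul_le_of_le_one_right (abs_nonneg _) (Real.abs_cos_le_one _)).trans
          (phS_abs hω hn _))
    have e : |π - -π| = 2 * π := by rw [abs_of_pos] <;> linarith [Real.pi_pos]
    rw [e, Real.norm_eq_abs] at h1
    exact h1.trans (le_of_eq (by ring))
  set F : ℕ → ℝ := fun k => ψ (k + 1) * I (k + 1) with hF
  have hFs : HasSum F (∫ t in (-π)..π, phS ω n (x - t) * PsiKer ψ β t) := hsum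
  set g : ℕ → ℕ := fun i => (2 * i + 1) * n - 1 with hg
  have hg1 : ∀ i, g i + 1 = (2 * i + 1) * n := fun i => by
    have : 0 < (2 * i + 1) * n := by positivity
    simp only [hg]; omega
  have hginj : Function.Injective g := by
    intro i j hij
    have h1 := hg1 i
    rw [hij, hg1 j] at h1
    have := Nat.eq_of_mul_eq_mul_right hn h1
    omega
  have hsupp : Function.support F ⊆ Set.range g := by
    intro k hk
    by_contra hne
    apply hk
    simp only [hF]
    have : I (k + 1) = 0 := by
      refine anti_term hn hphc phS_per (phS_anti hω.2.2.2.1 hn) x θ (k + 1) fun h0 => hne ?_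
      obtain ⟨m, hm⟩ := Real.cos_eq_zero_iff.1 h0
      have h1 : ((k + 1 : ℕ) : ℝ) = (2 * m + 1) * n := by
        have hpi := Real.pi_pos
        field_simp at hm
        linarith
      have h2 : ((k + 1 : ℕ) : ℤ) = (2 * m + 1) * n := by exact_mod_cast h1
      have h3 : 0 ≤ m := by
        by_contra hm0
        have : (2 * m + 1) * (n:ℤ) ≤ 0 :=
          mul_nonpos_of_nonpos_of_nonneg (by omega) (by positivity)
        omega
      lift m to ℕ using h3
      refine ⟨m, ?_⟩
      have h4 : k + 1 = (2 * m + 1) * n := by exact_mod_cast h2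
      have := hg1 m
      omega
    rw [this, mul_zero]
  have hFn : Summable (fun i => F (g i)) := hFs.summable.comp_injective hginj
  have e1 : ∫ t in (-π)..π, phS ω n (x - t) * PsiKer ψ β t = F (g 0) + ∑' i, F (g (i + 1)) := by
    rw [← hFs.tsum_eq, ← hginj.tsum_eq hsupp, hFn.tsum_eq_zero_add]
  have e2 : F (g 0) = ψ n * (2 * eN n ω) := by
    have hg0 : g 0 + 1 = n := by rw [hg1]; ring
    have hg0' : ((g 0 : ℕ) : ℝ) + 1 = n := by exact_mod_cast hg0
    simp only [hF, hg0, hg0']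
    rw [← phS_term hω hc hn θ]
  have hcast : ∀ i : ℕ, ((g (i + 1) : ℕ) : ℝ) + 1 = 2 * n * i + 3 * n := by
    intro i
    have : ((g (i + 1) + 1 : ℕ) : ℝ) = (((2 * (i + 1) + 1) * n : ℕ) : ℝ) := by rw [hg1]
    push_cast at this
    rw [this]; ring
  have hq0 : ∀ i : ℕ, 0 ≤ ψ (2 * n * i + 3 * n) := fun i => (hpos _ (by
    have : (0:ℝ) ≤ 2 * n * i := by positivity
    linarith)).le
  have hqs : Summable (fun i : ℕ => ψ (2 * n * i + 3 * n)) :=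
    summable_of_sum_range_le hq0 (psi_odd h hn hμ2)
  have hqt : ∑' i : ℕ, ψ (2 * n * i + 3 * n) ≤ 4 * ψ (3 * n) :=
    Real.tsum_le_of_sum_range_le hq0 (psi_odd h hn hμ2)
  have h3 := tsum_of_norm_bounded (f := fun i => F (g (i + 1))) (hqs.mul_right (5 * π * W)).hasSum
    (fun i => by
      simp only [hF]
      rw [hcast, Real.norm_eq_abs, abs_mul, abs_of_nonneg (hq0 i)]
      exact mul_le_mul_of_nonneg_left (hIb _) (hq0 i))
  rw [tsum_mul_right, Real.norm_eq_abs] at h3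
  have h4 : (∑' i : ℕ, ψ (2 * n * i + 3 * n)) * (5 * π * W) ≤ 4 * ψ (3 * n) * (5 * π * W) :=
    mul_le_mul_of_nonneg_right hqt (by positivity)
  have h5 := (abs_le.1 (h3.trans h4)).1
  unfold fS
  rw [e1, e2, one_div, le_inv_mul_iff₀ Real.pi_pos]
  have e3 : π * (2 / π * ψ n * eN n ω - 20 * ψ (3 * n) * W) =
    ψ n * (2 * eN n ω) - 4 * ψ (3 * n) * (5 * π * W) := by field_simp; ring
  rw [e3]
  linarith

/-- For convex moduli of continuity,
`E_n(C^ψ_β H_{ω_C})_C = (2/π) ψ(n) e_n(ω) + O(1) γ_n(ψ) ω(1/n)` whenever `μ(n) > 2`. -/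
theorem statement0 :
    ∃ K : ℝ, 0 < K ∧ ∀ ψ η : ℝ → ℝ, IsMInfPlus ψ η → ∀ β : ℝ, ∀ ω : ℝ → ℝ,
      IsModulus ω → ConcaveOn ℝ (Set.Ici 0) ω → ∀ n : ℕ,
      2 < (n : ℝ) / (η n - n) →
      |EnCClass n (CClass ψ β ω) - (2 / π) * ψ n * eN n ω| ≤
        K * gammaN ψ η n * ω (1 / n) := by
  refine ⟨10000000, by norm_num, fun ψ η h β ω hω hc n hμ2 => ?_⟩
  have hn : 0 < n := by
    rcases Nat.eq_zero_or_pos n with h0 | h0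
    · subst h0; norm_num at hμ2
    · exact h0
  have hn1 : (1:ℝ) ≤ n := by exact_mod_cast hn
  have hW : 0 ≤ ω (1 / n) := hω.2.2.2.2 _ (by positivity)
  have hQ : 0 ≤ ψ (n + 1) := (h.1 _ (by linarith)).le
  have hP3 : 0 ≤ ψ (3 * n) := (h.1 _ (by linarith)).le
  have hd : 0 ≤ 1 / ((n : ℝ) / (η n - n) - 2) := by
    have : 0 < (n : ℝ) / (η n - n) - 2 := by linarith
    positivity
  set X := ψ (n + 1) * (1 / n + 1 / ((n : ℝ) / (η n - n) - 2)) with hX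
  have hX0 : 0 ≤ X := by positivity
  have hγ : X + ψ (3 * n) ≤ gammaN ψ η n := by
    unfold gammaN
    have : 0 ≤ ψ (3 * n) * max 0 (Real.log (η n - n)) := mul_nonneg hP3 (le_max_left _ _)
    rw [← hX, mul_add, mul_one]
    linarith
  have hup : ∀ e ∈ EnC n '' CClass ψ β ω, e ≤ (2 / π) * ψ n * eN n ω +
      10000000 * (X + ψ (3 * n)) * ω (1 / n) := by
    rintro _ ⟨f, hf, rfl⟩
    exact upper h hn hμ2 hω β hf
  have hmem : EnC n (fS ψ β ω n) ∈ EnC n '' CClass ψ β ω :=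
    ⟨_, fS_mem (psi_summable h hn rfl hμ2) h.1 β hω hc hn, rfl⟩
  have h1 : EnCClass n (CClass ψ β ω) ≤ _ := csSup_le ⟨_, hmem⟩ hup
  have h2 : EnC n (fS ψ β ω n) ≤ EnCClass n (CClass ψ β ω) := le_csSup ⟨_, hup⟩ hmem
  have h3 := lower h hn hμ2 hω hc β
  have h4 : (X + ψ (3 * n)) * ω (1 / n) ≤ gammaN ψ η n * ω (1 / n) :=
    mul_le_mul_of_nonneg_right hγ hW
  have h5 : 0 ≤ X * ω (1 / n) := mul_nonneg hX0 hW
  have h6 : 0 ≤ ψ (3 * n) * ω (1 / n) := mul_nonneg hP3 hW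
  rw [abs_le]
  constructor <;> nlinarith
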